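/- arXiv:2210.08680 — 3 statements merged into one kernel-verified Lean document; each statement's English description precedes it below -/
import Mathlib

section
/- There is a universal constant C such that for every ε ∈ (0,1) and every n ≥ C·ε^{−3} the following holds. Let H = ∑_{u<v} H_{uv} be a 2-local Hamiltonian on n qubits with interaction-strength matrix J_{uv} = ‖H_{uv}‖_∞. Then there exist a width s ≤ C·ε^{−2}, sets R^{ijk}, L^{ijk} ⊆ {1,…,n} and reals d^{ijk} (i,j ∈ {0,1,2,3}, k ∈ {1,…,s}) such that the cut-decomposed Hamiltonian H_D they define satisfies ‖H − H_D‖_∞ ≤ ε·n·‖J‖_F, where ‖·‖_∞ is the operator (spectral) norm. -/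
open scoped BigOperators ComplexOrder

noncomputable section

namespace QLH

/-- The operator (spectral) norm of a square complex matrix. -/
def opNorm {m : Type*} [Fintype m] [DecidableEq m] (A : Matrix m m ℂ) : ℝ :=
  ‖Matrix.toEuclideanCLM (𝕜 := ℂ) A‖

/-- A density matrix: positive semidefinite with unit trace. -/
def IsDensity {m : Type*} [Fintype m] (ρ : Matrix m m ℂ) : Prop :=
  ρ.PosSemidef ∧ ρ.trace = 1

/-- The (real) energy `Tr[Hρ]`. -/
def energy {m : Type*} [Fintype m] (H ρ : Matrix m m ℂ) : ℝ :=
  ((H * ρ).trace).re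

/-- `A` acts (nontrivially) only on the sites in `e`. -/
def ActsOn {n : ℕ} {α : Type*} [Fintype α] [DecidableEq α]
    (A : Matrix (Fin n → α) (Fin n → α) ℂ) (e : Finset (Fin n)) : Prop :=
  ∃ M : Matrix ({u // u ∈ e} → α) ({u // u ∈ e} → α) ℂ,
    ∀ x y, A x y =
      (if ∀ u ∉ e, x u = y u then (1 : ℂ) else 0) *
        M (fun u => x u.1) (fun u => y u.1)

/-- Tensor-product (product) state built from single-site matrices. -/
def prodState {n : ℕ} {α : Type*} [Fintype α] (σ : Fin n → Matrix α α ℂ) :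
    Matrix (Fin n → α) (Fin n → α) ℂ :=
  fun x y => ∏ u, σ u (x u) (y u)

/-- The Pauli matrices: `σ_0 = I`, `σ_1 = X`, `σ_2 = Y`, `σ_3 = Z`. -/
def pauli : Fin 4 → Matrix (Fin 2) (Fin 2) ℂ :=
  ![1, !![0, 1; 1, 0], !![0, -Complex.I; Complex.I, 0], !![1, 0; 0, -1]]

/-- The two-site operator `σ_i^{(u)} σ_j^{(v)}` on `n` qubits (for `u ≠ v`). -/
def pauliAt {n : ℕ} (i : Fin 4) (u : Fin n) (j : Fin 4) (v : Fin n) :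
    Matrix (Fin n → Fin 2) (Fin n → Fin 2) ℂ :=
  fun x y =>
    pauli i (x u) (y u) * pauli j (x v) (y v) *
      ∏ w : Fin n, if w = u ∨ w = v then (1 : ℂ) else if x w = y w then 1 else 0

/-- The cut-decomposed Hamiltonian
`H_D = (1/2) ∑_{i,j,k} d^{ijk} ∑_{u ≠ v, u ∈ R^{ijk}, v ∈ L^{ijk}} σ_i^{(u)} σ_j^{(v)}`. -/
def cutHam {n s : ℕ} (R L : Fin 4 → Fin 4 → Fin s → Finset (Fin n))
    (dc : Fin 4 → Fin 4 → Fin s → ℝ) : Matrix (Fin n → Fin 2) (Fin n → Fin 2) ℂ :=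
  (2 : ℂ)⁻¹ •
    ∑ i : Fin 4, ∑ j : Fin 4, ∑ k : Fin s, (dc i j k : ℂ) •
      ∑ u ∈ R i j k, ∑ v ∈ L i j k, if u = v then 0 else pauliAt i u j v

/-- The 2-local Hamiltonian `H = ∑_{u < v} H_{uv}`. -/
def twoLocalSum {n : ℕ} (Huv : Fin n → Fin n → Matrix (Fin n → Fin 2) (Fin n → Fin 2) ℂ) :
    Matrix (Fin n → Fin 2) (Fin n → Fin 2) ℂ :=
  ∑ u : Fin n, ∑ v ∈ Finset.univ.filter (fun v => u < v), Huv u v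

/-- `‖J‖_F = (∑_{u ≠ v} J_{uv}²)^{1/2}` for the interaction-strength matrix
`J_{uv} = ‖H_{uv}‖_∞`. -/
def frobJ {n : ℕ} (Huv : Fin n → Fin n → Matrix (Fin n → Fin 2) (Fin n → Fin 2) ℂ) : ℝ :=
  Real.sqrt (∑ u : Fin n, ∑ v : Fin n, if u = v then 0 else opNorm (Huv u v) ^ 2)

/-! ### Classical weak regularity -/

lemma sum_rect {n : ℕ} {E : Type*} [AddCommMonoid E] (W : Fin n → Fin n → E)
    (S T : Finset (Fin n)) :
    ∑ u ∈ S, ∑ v ∈ T, W u v = ∑ u, ∑ v, if u ∈ S then (if v ∈ T then W u v else 0) else 0 := by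
  rw [← Finset.sum_subset (Finset.subset_univ S)]
  · refine Finset.sum_congr rfl fun u hu => ?_
    simp [hu]
  · intro u _ hu
    simp [hu]

lemma cut_step {n : ℕ} (W : Fin n → Fin n → ℝ) (S T : Finset (Fin n)) (e : ℝ) (he : 0 ≤ e)
    (h : e * n < |∑ u ∈ S, ∑ v ∈ T, W u v|) :
    ∃ d : ℝ, ∑ u, ∑ v, (W u v - d * (if u ∈ S then 1 else 0) * (if v ∈ T then 1 else 0)) ^ 2
      ≤ ∑ u, ∑ v, W u v ^ 2 - e ^ 2 := by
  set m := ∑ u ∈ S, ∑ v ∈ T, W u v with hm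
  have key : ∀ d : ℝ,
      ∑ u, ∑ v, (W u v - d * (if u ∈ S then 1 else 0) * (if v ∈ T then 1 else 0)) ^ 2
      = ∑ u, ∑ v, W u v ^ 2 - 2 * d * m + d ^ 2 * ((S.card : ℝ) * T.card) := by
    intro d
    have h2 : ((S.card : ℝ) * T.card)
        = ∑ u : Fin n, ∑ v : Fin n, (if u ∈ S then (1:ℝ) else 0) * (if v ∈ T then 1 else 0) := by
      rw [← Finset.sum_mul_sum]; simp
    rw [hm, sum_rect W S T, h2, Finset.mul_sum, Finset.mul_sum, ← Finset.sum_sub_distrib,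
      ← Finset.sum_add_distrib]
    refine Finset.sum_congr rfl fun u _ => ?_
    rw [Finset.mul_sum, Finset.mul_sum, ← Finset.sum_sub_distrib, ← Finset.sum_add_distrib]
    refine Finset.sum_congr rfl fun v _ => ?_
    split_ifs <;> ring
  have hS : (S.card : ℝ) ≤ n := by
    have := Finset.card_le_univ S
    rw [Fintype.card_fin] at this; exact_mod_cast this
  have hT : (T.card : ℝ) ≤ n := by
    have := Finset.card_le_univ T
    rw [Fintype.card_fin] at this; exact_mod_cast this
  have hm0 : m ≠ 0 := by
    intro h0
    rw [h0, abs_zero] at h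
    have : 0 ≤ e * n := by positivity
    linarith
  have hS0 : 0 < (S.card : ℝ) := by
    have : S.Nonempty := by
      rw [Finset.nonempty_iff_ne_empty]; rintro rfl; simp [hm] at hm0
    exact_mod_cast this.card_pos
  have hT0 : 0 < (T.card : ℝ) := by
    have : T.Nonempty := by
      rw [Finset.nonempty_iff_ne_empty]; rintro rfl; simp [hm] at hm0
    exact_mod_cast this.card_pos
  have hq : 0 < (S.card : ℝ) * T.card := by positivity
  refine ⟨m / ((S.card : ℝ) * T.card), ?_⟩
  rw [key]
  set q := (S.card : ℝ) * T.card
  have hqn : q ≤ n * n := mul_le_mul hS hT hT0.le (by positivity)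
  have hm2 : e ^ 2 * q ≤ m ^ 2 := by
    have h1 : (e * n) ^ 2 ≤ |m| ^ 2 := pow_le_pow_left₀ (by positivity) h.le 2
    rw [sq_abs] at h1
    nlinarith [mul_le_mul_of_nonneg_left hqn (sq_nonneg e)]
  have h3 : e ^ 2 ≤ m ^ 2 / q := by rwa [le_div_iff₀ hq]
  have h4 : -2 * (m / q) * m + (m / q) ^ 2 * q = - (m ^ 2 / q) := by
    field_simp; ring
  linarith

lemma cut_decomp {n : ℕ} (A : Fin n → Fin n → ℝ) (δ F : ℝ) (hδ : 0 ≤ δ) (hF : 0 ≤ F)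
    (hA : ∑ u, ∑ v, A u v ^ 2 ≤ F ^ 2) (k : ℕ) :
    ∃ (R L : Fin k → Finset (Fin n)) (d : Fin k → ℝ),
      (∀ S T : Finset (Fin n), |∑ u ∈ S, ∑ v ∈ T, (A u v -
        ∑ l, d l * (if u ∈ R l then 1 else 0) * (if v ∈ L l then 1 else 0))| ≤ δ * F * n) ∨
      ∑ u, ∑ v, (A u v -
        ∑ l, d l * (if u ∈ R l then 1 else 0) * (if v ∈ L l then 1 else 0)) ^ 2
          ≤ F ^ 2 * (1 - k * δ ^ 2) := by
  induction k with
  | zero => exact ⟨fun _ => ∅, fun _ => ∅, fun _ => 0, Or.inr (by simpa using hA)⟩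
  | succ k ih =>
    obtain ⟨R, L, d, h⟩ := ih
    by_cases hg : ∀ S T : Finset (Fin n), |∑ u ∈ S, ∑ v ∈ T, (A u v -
        ∑ l, d l * (if u ∈ R l then 1 else 0) * (if v ∈ L l then 1 else 0))| ≤ δ * F * n
    · refine ⟨Fin.cons ∅ R, Fin.cons ∅ L, Fin.cons 0 d, Or.inl ?_⟩
      simpa [Fin.sum_univ_succ] using hg
    · have h := h.resolve_left hg
      push Not at hg
      obtain ⟨S, T, hST⟩ := hg
      obtain ⟨d', hd'⟩ := cut_step _ S T (δ * F) (by positivity) hST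
      refine ⟨Fin.cons S R, Fin.cons T L, Fin.cons d' d, Or.inr ?_⟩
      simp only [Fin.sum_univ_succ, Fin.cons_zero, Fin.cons_succ]
      push_cast
      calc _ = _ := by
            refine Finset.sum_congr rfl fun u _ => Finset.sum_congr rfl fun v _ => ?_
            rw [add_comm, ← sub_sub]
        _ ≤ _ := hd'
        _ ≤ _ := by linarith

lemma cut_decomp' {n : ℕ} (A : Fin n → Fin n → ℝ) (δ F : ℝ) (hδ : 0 ≤ δ) (hF : 0 ≤ F)
    (hA : ∑ u, ∑ v, A u v ^ 2 ≤ F ^ 2) (k : ℕ) (hk : 1 ≤ k * δ ^ 2) :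
    ∃ (R L : Fin k → Finset (Fin n)) (d : Fin k → ℝ),
      (∀ S T : Finset (Fin n), |∑ u ∈ S, ∑ v ∈ T, (A u v -
        ∑ l, d l * (if u ∈ R l then 1 else 0) * (if v ∈ L l then 1 else 0))| ≤ δ * F * n) := by
  obtain ⟨R, L, d, h | h⟩ := cut_decomp A δ F hδ hF hA k
  · exact ⟨R, L, d, h⟩
  · refine ⟨R, L, d, fun S T => ?_⟩
    have h0 := h.trans (mul_nonpos_of_nonneg_of_nonpos (sq_nonneg F) (by linarith))
    have hz : ∀ u v, A u v -
        ∑ l, d l * (if u ∈ R l then 1 else 0) * (if v ∈ L l then 1 else 0) = 0 := by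
      intro u v
      have h1 := le_antisymm h0
        (Finset.sum_nonneg fun u _ => Finset.sum_nonneg fun v _ => sq_nonneg _)
      rw [Finset.sum_eq_zero_iff_of_nonneg
        (fun u _ => Finset.sum_nonneg fun v _ => sq_nonneg _)] at h1
      have h2 := h1 u (Finset.mem_univ _)
      rw [Finset.sum_eq_zero_iff_of_nonneg (fun v _ => sq_nonneg _)] at h2
      exact pow_eq_zero_iff (two_ne_zero) |>.1 (h2 v (Finset.mem_univ _))
    simp only [hz]
    simp only [Finset.sum_const_zero, abs_zero]
    positivity

/-- From cuts to signs. -/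
lemma sign_bound {n : ℕ} (W : Fin n → Fin n → ℝ) (K : ℝ)
    (hW : ∀ S T : Finset (Fin n), |∑ u ∈ S, ∑ v ∈ T, W u v| ≤ K)
    (S : Finset (Fin n)) (t : Fin n → ℝ) (ht : ∀ w, t w = 1 ∨ t w = -1) :
    |∑ u, ∑ v, (if u ∈ S ∧ v ∉ S then W u v else 0) * (t u * t v)| ≤ 4 * K := by
  classical
  have e : ∑ u, ∑ v, (if u ∈ S ∧ v ∉ S then W u v else 0) * (t u * t v)
      = (∑ u ∈ S.filter (fun w => t w = 1), ∑ v ∈ Sᶜ.filter (fun w => t w = 1), W u v)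
      - (∑ u ∈ S.filter (fun w => t w = 1), ∑ v ∈ Sᶜ.filter (fun w => ¬ t w = 1), W u v)
      - (∑ u ∈ S.filter (fun w => ¬ t w = 1), ∑ v ∈ Sᶜ.filter (fun w => t w = 1), W u v)
      + (∑ u ∈ S.filter (fun w => ¬ t w = 1), ∑ v ∈ Sᶜ.filter (fun w => ¬ t w = 1), W u v) := by
    rw [sum_rect W (S.filter (fun w => t w = 1)) (Sᶜ.filter (fun w => t w = 1)),
      sum_rect W (S.filter (fun w => t w = 1)) (Sᶜ.filter (fun w => ¬ t w = 1)),
      sum_rect W (S.filter (fun w => ¬ t w = 1)) (Sᶜ.filter (fun w => t w = 1)),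
      sum_rect W (S.filter (fun w => ¬ t w = 1)) (Sᶜ.filter (fun w => ¬ t w = 1))]
    simp only [← Finset.sum_sub_distrib, ← Finset.sum_add_distrib]
    refine Finset.sum_congr rfl fun u _ => Finset.sum_congr rfl fun v _ => ?_
    simp only [Finset.mem_filter, Finset.mem_compl]
    have hne : ¬ ((-1 : ℝ) = 1) := by norm_num
    by_cases hu : u ∈ S <;> by_cases hv : v ∈ S <;> rcases ht u with h1 | h1 <;>
      rcases ht v with h2 | h2 <;> simp [hu, hv, h1, h2, hne]
  rw [e]
  have a1 := abs_le.1 (hW (S.filter (fun w => t w = 1)) (Sᶜ.filter (fun w => t w = 1)))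
  have a2 := abs_le.1 (hW (S.filter (fun w => t w = 1)) (Sᶜ.filter (fun w => ¬ t w = 1)))
  have a3 := abs_le.1 (hW (S.filter (fun w => ¬ t w = 1)) (Sᶜ.filter (fun w => t w = 1)))
  have a4 := abs_le.1 (hW (S.filter (fun w => ¬ t w = 1)) (Sᶜ.filter (fun w => ¬ t w = 1)))
  rw [abs_le]
  constructor <;> linarith [a1.1, a1.2, a2.1, a2.2, a3.1, a3.2, a4.1, a4.2]

/-! ### Commuting involutions -/

section Op

variable {E : Type*} [NormedAddCommGroup E] [InnerProductSpace ℂ E] [CompleteSpace E]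

lemma pyth (P : E →L[ℂ] E) (hP : IsSelfAdjoint P) (p q : E) (hp : P p = p) (hq : P q = -q) :
    ‖p + q‖ ^ 2 = ‖p‖ ^ 2 + ‖q‖ ^ 2 := by
  have h : inner ℂ p q = (0 : ℂ) := by
    have h1 : inner ℂ (P p) q = inner ℂ p (P q) := by
      conv_lhs => rw [← hP.adjoint_eq]
      exact ContinuousLinearMap.adjoint_inner_left P q p
    rw [hp, hq, inner_neg_right] at h1
    exact self_eq_neg.1 h1
  have := norm_add_sq_eq_norm_sq_add_norm_sq_of_inner_eq_zero p q h
  nlinarith [this]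

lemma inv_step (P A B : E →L[ℂ] E) (hP : IsSelfAdjoint P) (hPP : P * P = 1)
    (hA : Commute P A) (hB : Commute P B) (M : ℝ) (h1 : ‖A + B‖ ≤ M) (h2 : ‖A - B‖ ≤ M) :
    ‖A + P * B‖ ≤ M := by
  have hM : 0 ≤ M := (norm_nonneg _).trans h1
  refine ContinuousLinearMap.opNorm_le_bound _ hM fun x => ?_
  have hPP' : ∀ x, P (P x) = x := fun x => by
    have := congrArg (fun T : E →L[ℂ] E => T x) hPP
    simpa using this
  have hA' : ∀ x, P (A x) = A (P x) := fun x => by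
    have := congrArg (fun T : E →L[ℂ] E => T x) hA.eq
    simpa using this
  have hB' : ∀ x, P (B x) = B (P x) := fun x => by
    have := congrArg (fun T : E →L[ℂ] E => T x) hB.eq
    simpa using this
  set y : E := (2⁻¹ : ℂ) • (x + P x) with hy
  set z : E := (2⁻¹ : ℂ) • (x - P x) with hz
  have hPy : P y = y := by simp only [hy, map_smul, map_add, hPP', add_comm]
  have hPz : P z = -z := by
    simp only [hz, map_smul, map_sub, hPP', ← smul_neg, neg_sub]
  have hyz : y + z = x := by
    rw [hy, hz, ← smul_add, add_add_sub_cancel, ← two_smul ℂ x, smul_smul]; norm_num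
  have hyz' : y - z = P x := by
    rw [hy, hz, ← smul_sub, add_sub_sub_cancel, ← two_smul ℂ (P x), smul_smul]; norm_num
  have e : (A + P * B) x = (A + B) y + (A - B) z := by
    have : (A + B) y + (A - B) z = A (y + z) + B (y - z) := by
      simp only [ContinuousLinearMap.add_apply, ContinuousLinearMap.sub_apply, map_add, map_sub]
      abel
    rw [this, hyz, hyz']
    simp [hB']
  have p1 := pyth P hP ((A + B) y) ((A - B) z) (by simp [hA', hB', hPy])
    (by simp [hA', hB', hPz]; abel)
  have p2 := pyth P hP y z hPy hPz
  rw [hyz] at p2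
  rw [e]
  refine le_of_sq_le_sq ?_ (by positivity)
  rw [p1, mul_pow, p2]
  have q1 : ‖(A + B) y‖ ^ 2 ≤ (M * ‖y‖) ^ 2 :=
    pow_le_pow_left₀ (norm_nonneg _) ((A + B).le_of_opNorm_le h1 y) 2
  have q2 : ‖(A - B) z‖ ^ 2 ≤ (M * ‖z‖) ^ 2 :=
    pow_le_pow_left₀ (norm_nonneg _) ((A - B).le_of_opNorm_le h2 z) 2
  nlinarith

/-- The quadratic form in operators. -/
def quadOp {n : ℕ} (M : Fin n → Fin n → ℝ) (T : Fin n → (E →L[ℂ] E)) : E →L[ℂ] E :=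
  ∑ u, ∑ v, (M u v : ℂ) • (T u * T v)

lemma quadOp_update {n : ℕ} (M : Fin n → Fin n → ℝ) (hM : ∀ u, M u u = 0)
    (T : Fin n → (E →L[ℂ] E)) (w : Fin n) (P : E →L[ℂ] E) (hP : ∀ v, Commute P (T v)) :
    quadOp M (Function.update T w P) = quadOp M (Function.update T w 0)
      + P * ∑ v, ((M w v : ℂ) + (M v w : ℂ)) • T v := by
  have h1 : P * ∑ v, ((M w v : ℂ) + (M v w : ℂ)) • T v
      = ∑ u, ∑ v, ((if u = w then (M w v : ℂ) • (P * T v) else 0)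
        + (if v = w then (M u w : ℂ) • (P * T u) else 0)) := by
    simp only [Finset.sum_add_distrib, Finset.sum_ite_eq', Finset.mem_univ, if_true]
    rw [Finset.sum_comm (f := fun u v => if u = w then (M w v : ℂ) • (P * T v) else 0)]
    simp only [Finset.sum_ite_eq', Finset.mem_univ, if_true]
    rw [← Finset.sum_add_distrib, Finset.mul_sum]
    refine Finset.sum_congr rfl fun v _ => ?_
    rw [mul_smul_comm, add_smul]
  rw [h1, quadOp, quadOp, ← Finset.sum_add_distrib]
  refine Finset.sum_congr rfl fun u _ => ?_
  rw [← Finset.sum_add_distrib]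
  refine Finset.sum_congr rfl fun v _ => ?_
  by_cases hu : u = w
  · subst hu
    by_cases hv : v = u
    · subst hv; simp [hM]
    · simp [hv]
  · by_cases hv : v = w
    · subst hv; simp [hu, (hP u).eq]
    · simp [hu, hv]

lemma quadOp_bound_aux {n : ℕ} (M : Fin n → Fin n → ℝ) (hM : ∀ u, M u u = 0) (K : ℝ)
    (hK : ∀ t : Fin n → ℝ, (∀ w, t w = 1 ∨ t w = -1) →
      |∑ u, ∑ v, M u v * (t u * t v)| ≤ K) (Z : Finset (Fin n)) :
    ∀ T : Fin n → (E →L[ℂ] E), (∀ w, IsSelfAdjoint (T w)) → (∀ w, T w * T w = 1) →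
      (∀ u v, Commute (T u) (T v)) → (∀ w ∉ Z, T w = 1 ∨ T w = -1) → ‖quadOp M T‖ ≤ K := by
  classical
  induction Z using Finset.induction_on with
  | empty =>
    intro T _ _ _ hT
    choose t ht ht' using fun w => show ∃ t : ℝ, (t = 1 ∨ t = -1) ∧ T w = (t : ℂ) • 1 by
      rcases hT w (Finset.notMem_empty _) with h | h
      · exact ⟨1, Or.inl rfl, by simp [h]⟩
      · exact ⟨-1, Or.inr rfl, by simp [h]⟩
    have e : quadOp M T = ((∑ u, ∑ v, M u v * (t u * t v) : ℝ) : ℂ) • (1 : E →L[ℂ] E) := by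
      rw [quadOp]
      push_cast
      simp only [Finset.sum_smul]
      refine Finset.sum_congr rfl fun u _ => Finset.sum_congr rfl fun v _ => ?_
      rw [ht' u, ht' v, smul_mul_smul_comm, one_mul, smul_smul]
    rw [e, norm_smul, Complex.norm_real, Real.norm_eq_abs]
    calc _ ≤ |∑ u, ∑ v, M u v * (t u * t v)| * 1 :=
          mul_le_mul_of_nonneg_left ContinuousLinearMap.norm_id_le (abs_nonneg _)
      _ ≤ K := by rw [mul_one]; exact hK t ht
  | insert w Z hw ih =>
    intro T hsa hinv hcomm hT
    have upd : ∀ P : E →L[ℂ] E, (P = 1 ∨ P = -1) → ‖quadOp M (Function.update T w P)‖ ≤ K := by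
      intro P hP
      have c1 : ∀ Q : E →L[ℂ] E, Commute P Q := by
        intro Q; rcases hP with rfl | rfl
        · exact Commute.one_left Q
        · exact (Commute.one_left Q).neg_left
      refine ih _ ?_ ?_ ?_ ?_
      · intro v
        by_cases hv : v = w
        · subst hv; rw [Function.update_self]
          rcases hP with rfl | rfl
          · exact IsSelfAdjoint.one _
          · exact (IsSelfAdjoint.one _).neg
        · rw [Function.update_of_ne hv]; exact hsa v
      · intro v
        by_cases hv : v = w
        · subst hv; rw [Function.update_self]
          rcases hP with rfl | rfl <;> simp
        · rw [Function.update_of_ne hv]; exact hinv v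
      · intro u v
        by_cases hu : u = w
        · subst hu; rw [Function.update_self]; exact c1 _
        · by_cases hv : v = w
          · subst hv; rw [Function.update_self]; exact (c1 _).symm
          · rw [Function.update_of_ne hu, Function.update_of_ne hv]; exact hcomm u v
      · intro v hv
        by_cases hvw : v = w
        · subst hvw; rw [Function.update_self]; exact hP
        · rw [Function.update_of_ne hvw]; exact hT v (by simp [hvw, hv])
    have u1 := upd 1 (Or.inl rfl)
    have u2 := upd (-1) (Or.inr rfl)
    rw [quadOp_update M hM T w 1 (fun v => Commute.one_left _), one_mul] at u1
    rw [quadOp_update M hM T w (-1) (fun v => (Commute.one_left _).neg_left), neg_mul, one_mul,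
      ← sub_eq_add_neg] at u2
    have u3 := quadOp_update M hM T w (T w) (fun v => hcomm w v)
    rw [Function.update_eq_self] at u3
    rw [u3]
    refine inv_step (T w) _ _ (hsa w) (hinv w) ?_ ?_ K u1 u2
    · refine Commute.sum_right _ _ _ fun u _ => Commute.sum_right _ _ _ fun v _ => ?_
      refine Commute.smul_right ?_ _
      have : ∀ v, Commute (T w) (Function.update T w 0 v) := by
        intro v
        by_cases hv : v = w
        · subst hv; rw [Function.update_self]; exact Commute.zero_right _
        · rw [Function.update_of_ne hv]; exact hcomm w v
      exact (this u).mul_right (this v)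
    · exact Commute.sum_right _ _ _ fun v _ => Commute.smul_right (hcomm w v) _

lemma card_sep {n : ℕ} (u v : Fin n) (h : u ≠ v) :
    4 * (Finset.univ.filter (fun S : Finset (Fin n) => u ∈ S ∧ v ∉ S)).card = 2 ^ n := by
  have e : Finset.univ.filter (fun S : Finset (Fin n) => u ∈ S ∧ v ∉ S)
      = Finset.Icc {u} (Finset.univ.erase v) := by
    ext S
    simp only [Finset.mem_filter, Finset.mem_univ, true_and, Finset.mem_Icc, Finset.le_eq_subset,
      Finset.singleton_subset_iff]
    refine and_congr_right fun _ => ?_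
    constructor
    · intro hv w hw
      rw [Finset.mem_erase]; exact ⟨fun h => hv (h ▸ hw), Finset.mem_univ _⟩
    · intro hs hv
      exact (Finset.mem_erase.1 (hs hv)).1 rfl
  rw [e, Finset.card_Icc_finset (by simp [h]), Finset.card_erase_of_mem (Finset.mem_univ _)]
  simp only [Finset.card_univ, Fintype.card_fin, Finset.card_singleton]
  have hn : 2 ≤ n := by
    have := u.2; have := v.2
    have : (u : ℕ) ≠ v := fun h' => h (Fin.ext h')
    omega
  obtain ⟨m, rfl⟩ := Nat.exists_eq_add_of_le hn
  rw [show 2 + m - 1 - 1 = m by omega, pow_add]; norm_num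

/-- Decoupling. -/
lemma decouple {n : ℕ} (W : Fin n → Fin n → ℝ) (K : ℝ)
    (hW : ∀ S T : Finset (Fin n), |∑ u ∈ S, ∑ v ∈ T, W u v| ≤ K)
    (P Q : Fin n → (E →L[ℂ] E))
    (hP : ∀ w, IsSelfAdjoint (P w)) (hQ : ∀ w, IsSelfAdjoint (Q w))
    (hPP : ∀ w, P w * P w = 1) (hQQ : ∀ w, Q w * Q w = 1)
    (cPP : ∀ u v, u ≠ v → Commute (P u) (P v)) (cQQ : ∀ u v, u ≠ v → Commute (Q u) (Q v))
    (cPQ : ∀ u v, u ≠ v → Commute (P u) (Q v)) :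
    ‖∑ u, ∑ v, if u = v then 0 else (W u v : ℂ) • (P u * Q v)‖ ≤ 16 * K := by
  classical
  set X : E →L[ℂ] E := ∑ u, ∑ v, if u = v then 0 else (W u v : ℂ) • (P u * Q v) with hX
  let Y : Finset (Fin n) → (E →L[ℂ] E) := fun S =>
    quadOp (fun u v => if u ∈ S ∧ v ∉ S then W u v else 0) (fun w => if w ∈ S then P w else Q w)
  have hY : ∀ S, ‖Y S‖ ≤ 4 * K := by
    intro S
    refine quadOp_bound_aux _ ?_ _ (fun t ht => sign_bound W K hW S t ht) Finset.univ _
      ?_ ?_ ?_ ?_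
    · intro u; simp
    · intro w; split_ifs; exacts [hP w, hQ w]
    · intro w; split_ifs; exacts [hPP w, hQQ w]
    · intro u v
      by_cases huv : u = v
      · subst huv; exact Commute.refl _
      · split_ifs
        exacts [cPP _ _ huv, cPQ _ _ huv, (cPQ _ _ (Ne.symm huv)).symm, cQQ _ _ huv]
    · intro w hw; exact absurd (Finset.mem_univ w) hw
  have hsum : (2 ^ n : ℂ) • X = (4 : ℂ) • ∑ S, Y S := by
    have e1 : ∑ S, Y S = ∑ u, ∑ v, ∑ S : Finset (Fin n),
        if u ∈ S ∧ v ∉ S then (W u v : ℂ) • (P u * Q v) else 0 := by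
      simp only [Y, quadOp]
      rw [Finset.sum_comm]
      refine Finset.sum_congr rfl fun u _ => ?_
      rw [Finset.sum_comm]
      refine Finset.sum_congr rfl fun v _ => Finset.sum_congr rfl fun S _ => ?_
      by_cases h : u ∈ S ∧ v ∉ S
      · simp [h]
      · simp [h]
    rw [e1, hX, Finset.smul_sum, Finset.smul_sum]
    refine Finset.sum_congr rfl fun u _ => ?_
    rw [Finset.smul_sum, Finset.smul_sum]
    refine Finset.sum_congr rfl fun v _ => ?_
    by_cases huv : u = v
    · subst huv; simp
    · rw [if_neg huv, ← Finset.sum_filter, Finset.sum_const, ← Nat.cast_smul_eq_nsmul ℂ,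
        smul_smul (4 : ℂ), ← card_sep u v huv |> fun h => (by exact_mod_cast h.symm :
          (2 ^ n : ℂ) = 4 * ((Finset.univ.filter
            (fun S : Finset (Fin n) => u ∈ S ∧ v ∉ S)).card : ℂ))]
  have hn : (2 ^ n : ℝ) * ‖X‖ ≤ 4 * (2 ^ n * (4 * K)) := by
    have h1 := congrArg norm hsum
    rw [norm_smul, norm_smul] at h1
    have h2 : ‖(2 ^ n : ℂ)‖ = 2 ^ n := by simp
    have h3 : ‖(4 : ℂ)‖ = 4 := by simp
    rw [h2, h3] at h1
    rw [h1]
    refine mul_le_mul_of_nonneg_left ?_ (by norm_num)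
    calc _ ≤ ∑ S, ‖Y S‖ := norm_sum_le _ _
      _ ≤ ∑ S : Finset (Fin n), 4 * K := Finset.sum_le_sum fun S _ => hY S
      _ = _ := by simp [Finset.sum_const]
  have h2 : (0:ℝ) < 2 ^ n := by positivity
  have : (2 ^ n : ℝ) * ‖X‖ ≤ 2 ^ n * (16 * K) := by linarith
  exact le_of_mul_le_mul_left this h2

end Op

/-! ### Pauli operators -/

lemma prodState_mul {n : ℕ} (σ τ : Fin n → Matrix (Fin 2) (Fin 2) ℂ) :
    prodState σ * prodState τ = prodState (fun w => σ w * τ w) := by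
  ext x y
  simp only [Matrix.mul_apply, prodState]
  rw [Finset.prod_univ_sum]
  simp only [Fintype.piFinset_univ, Finset.prod_mul_distrib]

lemma prodState_one {n : ℕ} :
    prodState (fun _ : Fin n => (1 : Matrix (Fin 2) (Fin 2) ℂ)) = 1 := by
  ext x y
  simp only [prodState, Matrix.one_apply]
  by_cases h : x = y
  · subst h; simp
  · rw [if_neg h]
    obtain ⟨w, hw⟩ := Function.ne_iff.1 h
    exact Finset.prod_eq_zero (Finset.mem_univ w) (if_neg hw)

lemma prodState_herm {n : ℕ} (σ : Fin n → Matrix (Fin 2) (Fin 2) ℂ)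
    (h : ∀ w, (σ w).IsHermitian) : (prodState σ).IsHermitian := by
  ext x y
  simp only [Matrix.conjTranspose_apply, prodState, star_prod]
  exact Finset.prod_congr rfl fun w _ => (h w).apply _ _

/-- One-site Pauli operator. -/
def site {n : ℕ} (i : Fin 4) (u : Fin n) : Matrix (Fin n → Fin 2) (Fin n → Fin 2) ℂ :=
  prodState (fun w => if w = u then pauli i else 1)

lemma pauli_herm (i : Fin 4) : (pauli i).IsHermitian := by
  ext a b
  fin_cases i <;> fin_cases a <;> fin_cases b <;>
    simp [pauli, Matrix.conjTranspose_apply]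

lemma pauli_sq (i : Fin 4) : pauli i * pauli i = 1 := by
  ext a b
  fin_cases i <;> fin_cases a <;> fin_cases b <;>
    simp [pauli, Matrix.mul_apply, Fin.sum_univ_two]

lemma pauli_norm (i : Fin 4) (a b : Fin 2) : ‖pauli i a b‖ ≤ 1 := by
  fin_cases i <;> fin_cases a <;> fin_cases b <;>
    simp [pauli]

lemma pauli_complete (a b c d : Fin 2) :
    ∑ i, pauli i a b * pauli i c d = if a = d ∧ b = c then 2 else 0 := by
  fin_cases a <;> fin_cases b <;> fin_cases c <;> fin_cases d <;>
    simp [pauli, Fin.sum_univ_four] <;> norm_num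

lemma site_herm {n : ℕ} (i : Fin 4) (u : Fin n) : (site i u).IsHermitian := by
  refine prodState_herm _ fun w => ?_
  split_ifs
  · exact pauli_herm i
  · exact Matrix.isHermitian_one

lemma site_sq {n : ℕ} (i : Fin 4) (u : Fin n) : site i u * site i u = 1 := by
  rw [site, prodState_mul, ← prodState_one]
  congr 1; funext w
  split_ifs
  · exact pauli_sq i
  · simp

lemma site_comm {n : ℕ} (i j : Fin 4) (u v : Fin n) (h : u ≠ v) :
    Commute (site i u) (site j v) := by
  rw [Commute, SemiconjBy, site, site, prodState_mul, prodState_mul]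
  congr 1; funext w
  split_ifs with h1 h2
  · exact absurd (h1.symm.trans h2) h
  all_goals simp

lemma pauliAt_eq {n : ℕ} (i j : Fin 4) (u v : Fin n) (h : u ≠ v) :
    pauliAt i u j v = site i u * site j v := by
  rw [site, site, prodState_mul]
  ext x y
  simp only [pauliAt, prodState]
  have h1 : ∏ w, ((if w = u then pauli i else 1) * (if w = v then pauli j else 1)
        : Matrix (Fin 2) (Fin 2) ℂ) (x w) (y w)
      = ∏ w, ((if w = u then pauli i (x u) (y u) else 1) *
        ((if w = v then pauli j (x v) (y v) else 1) *
        (if w = u ∨ w = v then (1 : ℂ) else if x w = y w then 1 else 0))) := by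
    refine Finset.prod_congr rfl fun w _ => ?_
    by_cases hu : w = u
    · subst hu; simp [h]
    · by_cases hv : w = v
      · subst hv; simp [hu]
      · simp [hu, hv, Matrix.one_apply]
  rw [h1, Finset.prod_mul_distrib, Finset.prod_mul_distrib]
  simp [mul_assoc]

lemma entry_le {m : Type*} [Fintype m] [DecidableEq m] (A : Matrix m m ℂ) (x y : m) :
    ‖A x y‖ ≤ opNorm A := by
  have h1 := (Matrix.toEuclideanCLM (𝕜 := ℂ) A).le_opNorm (EuclideanSpace.single y 1)
  rw [EuclideanSpace.norm_single, norm_one, mul_one] at h1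
  have h2 := PiLp.norm_apply_le (Matrix.toEuclideanCLM (𝕜 := ℂ) A (EuclideanSpace.single y 1)) x
  have h3 : (Matrix.toEuclideanCLM (𝕜 := ℂ) A (EuclideanSpace.single y 1)) x = A x y := by
    simp [Matrix.ofLp_toEuclideanCLM]
  rw [h3] at h2
  exact h2.trans h1

lemma pauli_expand {n : ℕ} (H : Matrix (Fin n → Fin 2) (Fin n → Fin 2) ℂ) (u v : Fin n)
    (huv : u ≠ v) (hH : H.IsHermitian) (hact : ActsOn H {u, v}) :
    ∃ c : Fin 4 → Fin 4 → ℝ, (∀ i j, |c i j| ≤ 4 * opNorm H) ∧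
      H = ∑ i, ∑ j, (c i j : ℂ) • pauliAt i u j v := by
  classical
  let ext : Fin 2 → Fin 2 → (Fin n → Fin 2) := fun a b w => if w = u then a else
    if w = v then b else 0
  let m : Fin 2 → Fin 2 → Fin 2 → Fin 2 → ℂ := fun a b c d => H (ext a b) (ext c d)
  let cc : Fin 4 → Fin 4 → ℂ := fun i j =>
    4⁻¹ * ∑ a, ∑ b, ∑ c, ∑ d, m a b c d * (pauli i c a * pauli j d b)
  have hm : ∀ x y, H x y = (if ∀ w ∉ ({u, v} : Finset (Fin n)), x w = y w then (1 : ℂ) else 0)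
      * m (x u) (x v) (y u) (y v) := by
    obtain ⟨M, hM⟩ := hact
    intro x y
    have key : ∀ z : Fin n → Fin 2, (fun w : {w // w ∈ ({u, v} : Finset (Fin n))} => z w.1)
        = fun w => ext (z u) (z v) w.1 := by
      intro z; funext ⟨w, hw⟩
      simp only [Finset.mem_insert, Finset.mem_singleton] at hw
      rcases hw with rfl | rfl
      · simp [ext]
      · simp [ext, Ne.symm huv]
    rw [hM x y]
    simp only [m]
    rw [hM (ext _ _), ← key x, ← key y]
    rw [if_pos (c := ∀ w ∉ ({u, v} : Finset (Fin n)), ext (x u) (x v) w = ext (y u) (y v) w),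
      one_mul]
    intro w hw
    simp only [Finset.mem_insert, Finset.mem_singleton, not_or] at hw
    simp [ext, hw.1, hw.2]
  have hreal : ∀ i j, star (cc i j) = cc i j := by
    intro i j
    have hp : ∀ i a b, star (pauli i a b) = pauli i b a := fun i a b => (pauli_herm i).apply b a
    have hmm : ∀ a b c d, star (m a b c d) = m c d a b := fun a b c d => hH.apply _ _
    simp only [cc, star_mul', star_sum, hp, hmm]
    congr 1
    · simp
    · simp only [Fin.sum_univ_two]; ring
  have hre : ∀ i j, (((cc i j).re : ℝ) : ℂ) = cc i j := fun i j =>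
    Complex.conj_eq_iff_re.1 (hreal i j)
  refine ⟨fun i j => (cc i j).re, fun i j => ?_, ?_⟩
  · refine (Complex.abs_re_le_norm _).trans ?_
    simp only [cc]
    rw [norm_mul]
    have hb : ‖∑ a, ∑ b, ∑ c, ∑ d, m a b c d * (pauli i c a * pauli j d b)‖
        ≤ ∑ a : Fin 2, ∑ b : Fin 2, ∑ c : Fin 2, ∑ d : Fin 2, opNorm H := by
      refine norm_sum_le_of_le _ fun a _ => norm_sum_le_of_le _ fun b _ =>
        norm_sum_le_of_le _ fun c _ => norm_sum_le_of_le _ fun d _ => ?_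
      rw [norm_mul, norm_mul]
      have h1 := entry_le H (ext a b) (ext c d)
      have h2 : ‖pauli i c a‖ * ‖pauli j d b‖ ≤ 1 :=
        mul_le_one₀ (pauli_norm _ _ _) (norm_nonneg _) (pauli_norm _ _ _)
      calc _ ≤ opNorm H * 1 := mul_le_mul h1 h2 (by positivity) ((norm_nonneg _).trans h1)
        _ = _ := mul_one _
    have h4 : ‖(4⁻¹ : ℂ)‖ = 4⁻¹ := by simp
    rw [h4]
    simp only [Finset.sum_const, Finset.card_univ, Fintype.card_fin, nsmul_eq_mul] at hb
    push_cast at hb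
    linarith
  · simp only [hre]
    ext x y
    have hp : ∏ w : Fin n, (if w = u ∨ w = v then (1 : ℂ) else if x w = y w then 1 else 0)
        = if ∀ w ∉ ({u, v} : Finset (Fin n)), x w = y w then (1 : ℂ) else 0 := by
      split_ifs with h
      · refine Finset.prod_eq_one fun w _ => ?_
        by_cases hw : w = u ∨ w = v
        · rw [if_pos hw]
        · rw [if_neg hw, if_pos (h w (by simpa using hw))]
      · push Not at h
        obtain ⟨w, hw, hne⟩ := h
        refine Finset.prod_eq_zero (Finset.mem_univ w) ?_
        rw [if_neg (by simpa using hw), if_neg hne]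
    simp only [Matrix.sum_apply, Matrix.smul_apply, pauliAt, hp, smul_eq_mul]
    rw [hm x y]
    generalize (if ∀ w ∉ ({u, v} : Finset (Fin n)), x w = y w then (1 : ℂ) else 0) = g
    generalize x u = p; generalize x v = q; generalize y u = r; generalize y v = t
    have e : ∑ i, ∑ j, cc i j * (pauli i p r * pauli j q t * g)
        = g * (4⁻¹ * ∑ a, ∑ b, ∑ c, ∑ d, m a b c d *
          ((∑ i, pauli i c a * pauli i p r) * (∑ j, pauli j d b * pauli j q t))) := by
      simp only [cc, Fin.sum_univ_four, Fin.sum_univ_two]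
      ring
    rw [e]
    simp only [pauli_complete]
    congr 1
    fin_cases p <;> fin_cases q <;> fin_cases r <;> fin_cases t <;>
      simp [Fin.sum_univ_two] <;> ring

lemma pauli_sum_bound {n : ℕ} (W : Fin n → Fin n → ℝ) (K : ℝ)
    (hW : ∀ S T : Finset (Fin n), |∑ u ∈ S, ∑ v ∈ T, W u v| ≤ K) (i j : Fin 4) :
    opNorm (∑ u, ∑ v, if u = v then 0 else (W u v : ℂ) • pauliAt i u j v) ≤ 16 * K := by
  let φ := Matrix.toEuclideanCLM (n := Fin n → Fin 2) (𝕜 := ℂ)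
  have hsa : ∀ i (w : Fin n), IsSelfAdjoint (φ (site i w)) := fun i w => by
    have h : star (site i w) = site i w := site_herm i w
    rw [IsSelfAdjoint, ← map_star, h]
  have hsq : ∀ i (w : Fin n), φ (site i w) * φ (site i w) = 1 := fun i w => by
    rw [← map_mul, site_sq, map_one]
  have hc : ∀ i j (u v : Fin n), u ≠ v → Commute (φ (site i u)) (φ (site j v)) :=
    fun i j u v h => (site_comm i j u v h).map φ
  have := decouple W K hW (fun w => φ (site i w)) (fun w => φ (site j w)) (hsa i) (hsa j)
    (hsq i) (hsq j) (hc i i) (hc j j) (hc i j)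
  rw [opNorm]
  convert this using 2
  change φ _ = _
  simp only [map_sum]
  refine Finset.sum_congr rfl fun u _ => Finset.sum_congr rfl fun v _ => ?_
  by_cases h : u = v
  · simp [h]
  · rw [if_neg h, if_neg h, map_smul, pauliAt_eq _ _ _ _ h, map_mul]

lemma opNorm_sum_le {m ι : Type*} [Fintype m] [DecidableEq m] (s : Finset ι)
    (f : ι → Matrix m m ℂ) : opNorm (∑ i ∈ s, f i) ≤ ∑ i ∈ s, opNorm (f i) := by
  simp only [opNorm, map_sum]
  exact norm_sum_le _ _

/-- Hamiltonian weak regularity lemma.  There is a universal constant `C`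
such that for every `ε ∈ (0,1)` and `n ≥ C·ε⁻³`, every 2-local Hamiltonian on `n` qubits
admits a cut decomposition of width `s ≤ C·ε⁻²` whose cut-decomposed Hamiltonian `H_D`
satisfies `‖H − H_D‖_∞ ≤ ε·n·‖J‖_F`. -/
theorem hamiltonian_weak_regularity :
    ∃ C : ℝ, 0 < C ∧
      ∀ (ε : ℝ), 0 < ε → ε < 1 →
      ∀ (n : ℕ), C / ε ^ 3 ≤ (n : ℝ) →
      ∀ Huv : Fin n → Fin n → Matrix (Fin n → Fin 2) (Fin n → Fin 2) ℂ,
        (∀ u v, Huv u v = Huv v u) →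
        (∀ u, Huv u u = 0) →
        (∀ u v, (Huv u v).IsHermitian) →
        (∀ u v, ActsOn (Huv u v) {u, v}) →
        ∃ (s : ℕ) (R L : Fin 4 → Fin 4 → Fin s → Finset (Fin n))
          (dc : Fin 4 → Fin 4 → Fin s → ℝ),
          (s : ℝ) ≤ C / ε ^ 2 ∧
          opNorm (twoLocalSum Huv - cutHam R L dc) ≤ ε * n * frobJ Huv := by
  refine ⟨1024 ^ 2 + 1, by norm_num, ?_⟩
  intro ε hε hε1 n _ Huv _ _ hherm hact
  have hexp : ∀ u v : Fin n, ∃ c : Fin 4 → Fin 4 → ℝ, u ≠ v →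
      (∀ i j, |c i j| ≤ 4 * opNorm (Huv u v)) ∧
      Huv u v = ∑ i, ∑ j, (c i j : ℂ) • pauliAt i u j v := by
    intro u v
    by_cases h : u = v
    · exact ⟨0, fun h' => absurd h h'⟩
    · obtain ⟨c, hc⟩ := pauli_expand (Huv u v) u v h (hherm u v) (hact u v)
      exact ⟨c, fun _ => hc⟩
  choose c hc using hexp
  let A : Fin 4 → Fin 4 → Fin n → Fin n → ℝ := fun i j u v =>
    if u < v then 2 * c u v i j else 0
  have hF : 0 ≤ frobJ Huv := Real.sqrt_nonneg _
  have hA : ∀ i j, ∑ u, ∑ v, A i j u v ^ 2 ≤ (8 * frobJ Huv) ^ 2 := by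
    intro i j
    rw [mul_pow, frobJ, Real.sq_sqrt (Finset.sum_nonneg fun u _ => Finset.sum_nonneg fun v _ => by
      split_ifs <;> positivity), Finset.mul_sum]
    refine Finset.sum_le_sum fun u _ => ?_
    rw [Finset.mul_sum]
    refine Finset.sum_le_sum fun v _ => ?_
    by_cases h : u < v
    · simp only [A, if_pos h, if_neg h.ne]
      have h1 := (hc u v h.ne).1 i j
      have h2 : |c u v i j| ^ 2 ≤ (4 * opNorm (Huv u v)) ^ 2 :=
        pow_le_pow_left₀ (abs_nonneg _) h1 2
      rw [sq_abs] at h2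
      nlinarith
    · simp only [A, if_neg h]
      rw [zero_pow two_ne_zero]
      split_ifs <;> positivity
  set δ : ℝ := ε / 1024 with hδ
  have hδ0 : 0 < δ := by positivity
  obtain ⟨s, hs1, hs2⟩ : ∃ s : ℕ, 1 ≤ s * δ ^ 2 ∧ (s : ℝ) ≤ (1024 ^ 2 + 1) / ε ^ 2 := by
    refine ⟨⌈1 / δ ^ 2⌉₊, ?_, ?_⟩
    · have := Nat.le_ceil (1 / δ ^ 2)
      rwa [div_le_iff₀ (by positivity)] at this
    · have h1 := (Nat.ceil_lt_add_one (show 0 ≤ 1 / δ ^ 2 by positivity)).le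
      refine h1.trans ?_
      have h2 : 1 / δ ^ 2 = 1024 ^ 2 / ε ^ 2 := by rw [hδ]; field_simp
      have h3 : 1 ≤ 1 / ε ^ 2 := by
        rw [le_div_iff₀ (by positivity)]; nlinarith
      rw [h2, add_div]; linarith
  choose R L d hd using fun i j =>
    cut_decomp' (A i j) δ (8 * frobJ Huv) hδ0.le (by positivity) (hA i j) s hs1
  refine ⟨s, R, L, d, hs2, ?_⟩
  let W : Fin 4 → Fin 4 → Fin n → Fin n → ℝ := fun i j u v => A i j u v -
    ∑ l, d i j l * (if u ∈ R i j l then 1 else 0) * (if v ∈ L i j l then 1 else 0)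
  have e1 : twoLocalSum Huv = (2 : ℂ)⁻¹ • ∑ i, ∑ j, ∑ u, ∑ v,
      if u = v then 0 else (A i j u v : ℂ) • pauliAt i u j v := by
    have h1 : ∑ i, ∑ j, ∑ u, ∑ v, (if u = v then 0 else (A i j u v : ℂ) • pauliAt i u j v)
        = ∑ u, ∑ v, ∑ i, ∑ j, (if u = v then 0 else (A i j u v : ℂ) • pauliAt i u j v) := by
      simp only [← Fintype.sum_prod_type']
      refine Finset.sum_nbij' (fun p => (p.2.2.1, p.2.2.2, p.1, p.2.1))
        (fun p => (p.2.2.1, p.2.2.2, p.1, p.2.1)) ?_ ?_ ?_ ?_ ?_ <;> simp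
    rw [h1, twoLocalSum, Finset.smul_sum]
    refine Finset.sum_congr rfl fun u _ => ?_
    rw [Finset.smul_sum, Finset.sum_filter]
    refine Finset.sum_congr rfl fun v _ => ?_
    by_cases h : u < v
    · simp only [A, if_pos h, if_neg h.ne]
      conv_lhs => rw [(hc u v h.ne).2]
      rw [Finset.smul_sum]
      refine Finset.sum_congr rfl fun i _ => ?_
      rw [Finset.smul_sum]
      refine Finset.sum_congr rfl fun j _ => ?_
      rw [smul_smul]
      congr 1
      push_cast
      ring
    · simp [A, if_neg h]
  have e2 : cutHam R L d = (2 : ℂ)⁻¹ • ∑ i, ∑ j, ∑ u, ∑ v,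
      if u = v then 0 else
        ((∑ l, d i j l * (if u ∈ R i j l then 1 else 0) * (if v ∈ L i j l then 1 else 0) : ℝ) : ℂ)
          • pauliAt i u j v := by
    rw [cutHam]
    congr 1
    refine Finset.sum_congr rfl fun i _ => Finset.sum_congr rfl fun j _ => ?_
    have hr := fun l => sum_rect (fun u v : Fin n => if u = v then 0 else pauliAt i u j v)
      (R i j l) (L i j l)
    simp only [hr, Finset.smul_sum]
    rw [Finset.sum_comm]
    refine Finset.sum_congr rfl fun u _ => ?_
    rw [Finset.sum_comm]
    refine Finset.sum_congr rfl fun v _ => ?_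
    by_cases h : u = v
    · simp [h]
    · simp only [if_neg h]
      push_cast
      rw [Finset.sum_smul]
      refine Finset.sum_congr rfl fun l _ => ?_
      split_ifs <;> simp
  have e3 : twoLocalSum Huv - cutHam R L d = (2 : ℂ)⁻¹ • ∑ i, ∑ j, ∑ u, ∑ v,
      if u = v then 0 else (W i j u v : ℂ) • pauliAt i u j v := by
    rw [e1, e2, ← smul_sub]
    congr 1
    simp only [← Finset.sum_sub_distrib]
    refine Finset.sum_congr rfl fun i _ => Finset.sum_congr rfl fun j _ =>
      Finset.sum_congr rfl fun u _ => Finset.sum_congr rfl fun v _ => ?_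
    by_cases h : u = v
    · simp [h]
    · simp only [if_neg h, W]
      rw [← sub_smul, ← Complex.ofReal_sub]
  have hb : opNorm (∑ i, ∑ j, ∑ u, ∑ v,
      if u = v then 0 else (W i j u v : ℂ) • pauliAt i u j v)
      ≤ ∑ i : Fin 4, ∑ j : Fin 4, 16 * (δ * (8 * frobJ Huv) * n) :=
    (opNorm_sum_le _ _).trans <| Finset.sum_le_sum fun i _ =>
      (opNorm_sum_le _ _).trans <| Finset.sum_le_sum fun j _ =>
        pauli_sum_bound (W i j) _ (hd i j) i j
  rw [e3]
  have h2 : ∀ X : Matrix (Fin n → Fin 2) (Fin n → Fin 2) ℂ,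
      opNorm ((2 : ℂ)⁻¹ • X) = 2⁻¹ * opNorm X := by
    intro X
    rw [opNorm, opNorm, map_smul, norm_smul]; simp
  rw [h2]
  simp only [Finset.sum_const, Finset.card_univ, Fintype.card_fin, nsmul_eq_mul] at hb
  push_cast at hb
  rw [hδ] at hb
  linarith

end QLH
end
end

section
/- There is a universal constant C with the following property. Fix n qubits, cut data of width s consisting of sets R^{ijk}, L^{ijk} ⊆ {1,…,n} (i,j ∈ {0,1,2,3}, k ∈ {1,…,s}), guesses r = (r^{ijk}), c = (c^{ijk}), tolerance γ ∈ (0,1), δ ∈ (0,1), and an integer q ≤ n with q ≥ C·γ^{−2}·log((s+1)/δ). If the constraint set C_{r,c,γ} is nonempty, then for at least a (1−δ) proportion of all q-element subsets Q of {1,…,n}, the sampled constraint set C_{(q/n)r, (q/n)c, 2γ}(Q) is nonempty, where (q/n)r denotes the tuple with entries (q/n)·r^{ijk}. -/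
open scoped BigOperators ComplexOrder

noncomputable section

namespace QLH

/-- The magnetization `Tr[σ_i ρ]` of a single-qubit state `ρ` in the Pauli direction `i`. -/
def mag (i : Fin 4) (ρ : Matrix (Fin 2) (Fin 2) ℂ) : ℝ :=
  ((pauli i * ρ).trace).re

/-- The sampled constraint set `C_{r,c,γ}(Q)` is nonempty: there is a tuple of single-qubit
density matrices on `Q` whose subset magnetizations over `R^{ijk} ∩ Q` and `L^{ijk} ∩ Q` are
within `γ·|Q|` of the guesses `r, c`.  Taking `Q = univ` recovers the full constraint set
`C_{r,c,γ}`. -/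
def FeasibleOn {n s : ℕ} (Q : Finset (Fin n))
    (R L : Fin 4 → Fin 4 → Fin s → Finset (Fin n))
    (r c : Fin 4 → Fin 4 → Fin s → ℝ) (γ : ℝ) : Prop :=
  ∃ ρ : Fin n → Matrix (Fin 2) (Fin 2) ℂ,
    (∀ u ∈ Q, IsDensity (ρ u)) ∧
    (∀ i j k, |(∑ u ∈ R i j k ∩ Q, mag i (ρ u)) - r i j k| ≤ γ * Q.card) ∧
    (∀ i j k, |(∑ v ∈ L i j k ∩ Q, mag j (ρ v)) - c i j k| ≤ γ * Q.card)

/-- The number of elements of a finite type satisfying a (not necessarily decidable)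
predicate. -/
def propCount {β : Type*} [Fintype β] (P : β → Prop) : ℕ :=
  (@Finset.filter β P (Classical.decPred P) Finset.univ).card

lemma tangent_pow (q : ℕ) (x y : ℝ) (hx : 0 ≤ x) (hy : 0 ≤ y) :
    y ^ (q + 1) + (q + 1) * y ^ q * (x - y) ≤ x ^ (q + 1) := by
  induction q with
  | zero => simp
  | succ q ih =>
    have h1 := mul_le_mul_of_nonneg_left ih hx
    have h2 : 0 ≤ ((q : ℝ) + 1) * y ^ q * (x - y) ^ 2 := by positivity
    have e1 : x ^ (q + 1 + 1) = x * x ^ (q + 1) := by ring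
    rw [e1]
    refine le_trans ?_ h1
    push_cast
    have : x * (y ^ (q + 1) + (q + 1) * y ^ q * (x - y)) -
      (y ^ (q + 1 + 1) + ((q : ℝ) + 1 + 1) * y ^ (q + 1) * (x - y)) =
        ((q : ℝ) + 1) * y ^ q * (x - y) ^ 2 := by ring
    linarith

lemma maclaurin {α : Type*} [DecidableEq α] (a : α → ℝ) (ha : ∀ u, 0 ≤ a u) (s : Finset α) :
    ∀ q : ℕ, ∑ t ∈ s.powersetCard q, ∏ u ∈ t, a u ≤
      (s.card.choose q : ℝ) * ((∑ u ∈ s, a u) / s.card) ^ q := by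
  induction s using Finset.induction_on with
  | empty =>
    intro q
    cases q with
    | zero => simp
    | succ q => rw [Finset.powersetCard_eq_empty.2 (by simp)]; simp
  | insert x s hx ih =>
    intro q
    cases q with
    | zero => simp
    | succ q =>
      rw [Finset.powersetCard_succ_insert hx, Finset.sum_union, Finset.sum_image]
      · have e : ∑ t ∈ s.powersetCard q, ∏ u ∈ insert x t, a u =
            a x * ∑ t ∈ s.powersetCard q, ∏ u ∈ t, a u := by
          rw [Finset.mul_sum]
          refine Finset.sum_congr rfl fun t ht => ?_
          rw [Finset.prod_insert]
          exact fun h => hx ((Finset.mem_powersetCard.1 ht).1 h)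
        rw [e, Finset.sum_insert hx, Finset.card_insert_of_notMem hx]
        have hS : 0 ≤ ∑ u ∈ s, a u := Finset.sum_nonneg fun u _ => ha u
        set S := ∑ u ∈ s, a u with hSdef
        set m := S / s.card with hm
        have hm0 : 0 ≤ m := by positivity
        have hSm : S = s.card * m := by
          rcases Nat.eq_zero_or_pos s.card with h | h
          · have : s = ∅ := Finset.card_eq_zero.1 h
            simp [hSdef, this]
          · have : (s.card : ℝ) ≠ 0 := by positivity
            rw [hm, mul_div_cancel₀ _ this]
        have h1 := ih (q + 1)
        have h2 := mul_le_mul_of_nonneg_left (ih q) (ha x)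
        have h3 := tangent_pow q ((a x + S) / ((s.card + 1 : ℕ) : ℝ)) m
          (div_nonneg (add_nonneg (ha x) hS) (Nat.cast_nonneg _)) hm0
        have h4 := mul_le_mul_of_nonneg_left h3
          (Nat.cast_nonneg (α := ℝ) ((s.card + 1).choose (q + 1)))
        refine (add_le_add h1 h2).trans (le_trans (le_of_eq ?_) h4)
        have hx1 : (a x + S) / ((s.card + 1 : ℕ) : ℝ) - m = (a x - m) / ((s.card : ℝ) + 1) := by
          have : (s.card : ℝ) + 1 ≠ 0 := Nat.cast_add_one_ne_zero _
          rw [hSm, Nat.cast_add, Nat.cast_one, div_sub' this]; congr 1; ring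
        rw [hx1]
        have c1 : ((s.card + 1).choose (q + 1) : ℝ) * (q + 1) =
            (s.card + 1) * (s.card.choose q : ℝ) := by
          exact_mod_cast (Nat.add_one_mul_choose_eq s.card q).symm
        have c2 : ((s.card + 1).choose (q + 1) : ℝ) =
            (s.card.choose q : ℝ) + (s.card.choose (q + 1) : ℝ) := by
          exact_mod_cast Nat.choose_succ_succ s.card q
        have c3 : ((s.card + 1).choose (q + 1) : ℝ) *
            (m ^ (q + 1) + (q + 1) * m ^ q * ((a x - m) / ((s.card : ℝ) + 1))) =
            ((s.card + 1).choose (q + 1) : ℝ) * m ^ (q + 1) +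
            (((s.card + 1).choose (q + 1) : ℝ) * (q + 1)) * m ^ q *
              ((a x - m) / ((s.card : ℝ) + 1)) := by ring
        rw [c3, c1, c2]
        have hne : (s.card : ℝ) + 1 ≠ 0 := Nat.cast_add_one_ne_zero _
        have c4 : ((s.card : ℝ) + 1) * ((a x - m) / ((s.card : ℝ) + 1)) = a x - m :=
          mul_div_cancel₀ _ hne
        linear_combination (-(s.card.choose q : ℝ) * m ^ q) * c4
      · intro t ht t' ht' h
        have h1 : x ∉ t := fun h => hx ((Finset.mem_powersetCard.1 ht).1 h)
        have h2 : x ∉ t' := fun h => hx ((Finset.mem_powersetCard.1 ht').1 h)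
        have := congrArg (fun z => z.erase x) h
        simpa [Finset.erase_insert h1, Finset.erase_insert h2] using this
      · rw [Finset.disjoint_left]
        intro t ht ht'
        obtain ⟨t', _, rfl⟩ := Finset.mem_image.1 ht'
        exact hx ((Finset.mem_powersetCard.1 ht).1 (Finset.mem_insert_self _ _))

open Classical in
lemma tail {n q : ℕ} (hn : 0 < n) (y : Fin n → ℝ) (hy : ∀ u, |y u| ≤ 1) (γ : ℝ) (h0 : 0 < γ)
    (h1 : γ < 1) :
    (((Finset.univ.powersetCard q).filter
      (fun Q : Finset (Fin n) => γ * q < ∑ u ∈ Q, y u - (q : ℝ) / n * ∑ u, y u)).card : ℝ) ≤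
      (n.choose q : ℝ) * Real.exp (-(γ ^ 2 * q / 16)) := by
  have hn' : (0 : ℝ) < n := by exact_mod_cast hn
  set m := (∑ u, y u) / n with hm
  have hnm : ∑ u, y u = n * m := by rw [hm]; field_simp
  have hm1 : |m| ≤ 1 := by
    rw [hm, abs_div, abs_of_pos hn', div_le_one hn']
    refine (Finset.abs_sum_le_sum_abs _ _).trans ?_
    refine (Finset.sum_le_sum fun u _ => hy u).trans ?_
    simp
  set t := γ / 8 with ht
  have hM := maclaurin (fun u => Real.exp (t * (y u - m))) (fun u => (Real.exp_pos _).le)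
    Finset.univ q
  have hmean : (∑ u, Real.exp (t * (y u - m))) / n ≤ Real.exp (4 * t ^ 2) := by
    rw [div_le_iff₀ hn']
    have hb : ∀ u, Real.exp (t * (y u - m)) ≤ 1 + t * (y u - m) + 4 * t ^ 2 := by
      intro u
      have hd : |y u - m| ≤ 2 := by
        have := abs_sub (y u) m
        linarith [hy u]
      have hd2 : (y u - m) ^ 2 ≤ 4 := by
        rw [← sq_abs]; nlinarith [abs_nonneg (y u - m)]
      have hz : |t * (y u - m)| ≤ 1 := by
        rw [abs_mul, abs_of_pos (by positivity : 0 < t)]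
        nlinarith [abs_nonneg (y u - m)]
      have := (abs_le.1 (Real.abs_exp_sub_one_sub_id_le hz)).2
      nlinarith [sq_nonneg t]
    refine (Finset.sum_le_sum fun u _ => hb u).trans ?_
    have : ∑ u, (1 + t * (y u - m) + 4 * t ^ 2) = (1 + 4 * t ^ 2) * n := by
      simp only [Finset.sum_add_distrib, ← Finset.mul_sum, Finset.sum_sub_distrib, hnm]
      simp
      ring
    rw [this]
    have := Real.add_one_le_exp (4 * t ^ 2)
    nlinarith
  have hM2 : ∑ Q ∈ (Finset.univ : Finset (Fin n)).powersetCard q,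
      ∏ u ∈ Q, Real.exp (t * (y u - m)) ≤ (n.choose q : ℝ) * Real.exp (4 * t ^ 2 * q) := by
    refine hM.trans ?_
    rw [Finset.card_univ, Fintype.card_fin]
    have : Real.exp (4 * t ^ 2 * q) = Real.exp (4 * t ^ 2) ^ q := by
      rw [← Real.exp_nat_mul]; ring_nf
    rw [this]
    refine mul_le_mul_of_nonneg_left (pow_le_pow_left₀ ?_ hmean q) (Nat.cast_nonneg _)
    exact div_nonneg (Finset.sum_nonneg fun u _ => (Real.exp_pos _).le) (Nat.cast_nonneg _)
  set B := (Finset.univ.powersetCard q).filter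
      (fun Q : Finset (Fin n) => γ * q < ∑ u ∈ Q, y u - (q : ℝ) / n * ∑ u, y u) with hB
  have hlow : (B.card : ℝ) * Real.exp (t * (γ * q)) ≤
      ∑ Q ∈ (Finset.univ : Finset (Fin n)).powersetCard q,
        ∏ u ∈ Q, Real.exp (t * (y u - m)) := by
    rw [← nsmul_eq_mul]
    refine (Finset.card_nsmul_le_sum B _ _ ?_).trans
      (Finset.sum_le_sum_of_subset_of_nonneg (Finset.filter_subset _ _) ?_)
    · intro Q hQ
      rw [hB, Finset.mem_filter] at hQ
      obtain ⟨hc, hQ⟩ := hQ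
      have hc := (Finset.mem_powersetCard.1 hc).2
      rw [← Real.exp_sum, ← Finset.mul_sum, Finset.sum_sub_distrib]
      apply Real.exp_le_exp.2
      refine mul_le_mul_of_nonneg_left ?_ (by positivity)
      rw [hnm] at hQ
      have : (q : ℝ) / n * (n * m) = q * m := by field_simp
      simp only [Finset.sum_const, hc, nsmul_eq_mul]
      linarith
    · intro Q _ _
      exact Finset.prod_nonneg fun u _ => (Real.exp_pos _).le
  have h := hlow.trans hM2
  rw [← le_div_iff₀ (Real.exp_pos _), mul_div_assoc, ← Real.exp_sub] at h
  refine h.trans (le_of_eq ?_)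
  congr 2
  rw [ht]; ring

lemma mag_le (i : Fin 4) (ρ : Matrix (Fin 2) (Fin 2) ℂ) (h : IsDensity ρ) : |mag i ρ| ≤ 1 := by
  obtain ⟨hp, ht⟩ := h
  have h0 := hp.diag_nonneg (i := 0)
  have h1 := hp.diag_nonneg (i := 1)
  have hd := hp.det_nonneg
  have hh := hp.isHermitian.apply 0 1
  rw [Matrix.det_fin_two] at hd
  rw [Matrix.trace_fin_two] at ht
  rw [← hh] at hd
  rw [Complex.le_def] at h0 h1 hd
  have htr := congrArg Complex.re ht
  simp at h0 h1 hd htr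
  have hre := congrArg Complex.re hh
  have him := congrArg Complex.im hh
  simp at hre him
  rw [← h0.2, ← h1.2] at hd
  set a := (ρ 0 0).re
  set b := (ρ 1 1).re
  set x := (ρ 1 0).re
  set z := (ρ 1 0).im
  have hab : b = 1 - a := by linarith
  have hd1 := hd.1
  have key : x ^ 2 + z ^ 2 ≤ 1 / 4 := by nlinarith [sq_nonneg (a - 1 / 2)]
  have hx : |x| ≤ 1 / 2 := abs_le_of_sq_le_sq (by nlinarith [sq_nonneg z]) (by norm_num)
  have hz : |z| ≤ 1 / 2 := abs_le_of_sq_le_sq (by nlinarith [sq_nonneg x]) (by norm_num)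
  rw [abs_le] at hx hz ⊢
  fin_cases i <;>
    simp [mag, pauli, Matrix.trace_fin_two, Matrix.mul_apply, Matrix.vecMul, dotProduct,
      Fin.sum_univ_two] <;>
    constructor <;> linarith [h0.1, h1.1]

open Classical in
lemma family {ι : Type*} [Fintype ι] {n q : ℕ} (hn : 0 < n) (y : ι → Fin n → ℝ)
    (hy : ∀ e u, |y e u| ≤ 1) (γ : ℝ) (h0 : 0 < γ) (h1 : γ < 1) (P : Finset (Fin n) → Prop)
    (hP : ∀ Q : Finset (Fin n), Q.card = q →
      (∀ e, ∑ u ∈ Q, y e u - (q : ℝ) / n * ∑ u, y e u ≤ γ * q) → P Q) :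
    (n.choose q : ℝ) ≤ (propCount (fun Q : Finset (Fin n) => Q.card = q ∧ P Q) : ℝ) +
      (Fintype.card ι : ℝ) * ((n.choose q : ℝ) * Real.exp (-(γ ^ 2 * q / 16))) := by
  let B : ι → Finset (Finset (Fin n)) := fun e => (Finset.univ.powersetCard q).filter
      (fun Q : Finset (Fin n) => γ * q < ∑ u ∈ Q, y e u - (q : ℝ) / n * ∑ u, y e u)
  let G : Finset (Finset (Fin n)) :=
    @Finset.filter _ (fun Q : Finset (Fin n) => Q.card = q ∧ P Q)
      (Classical.decPred (fun Q : Finset (Fin n) => Q.card = q ∧ P Q)) Finset.univ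
  have hsub : (Finset.univ : Finset (Fin n)).powersetCard q ⊆ G ∪ Finset.univ.biUnion B := by
    intro Q hQ
    have hc := (Finset.mem_powersetCard.1 hQ).2
    rw [Finset.mem_union]
    by_cases hg : ∀ e, ∑ u ∈ Q, y e u - (q : ℝ) / n * ∑ u, y e u ≤ γ * q
    · left
      exact (@Finset.mem_filter _ _ (Classical.decPred _) _ _).2 ⟨Finset.mem_univ _, hc, hP Q hc hg⟩
    · right
      push Not at hg
      obtain ⟨e, he⟩ := hg
      exact Finset.mem_biUnion.2 ⟨e, Finset.mem_univ _, Finset.mem_filter.2 ⟨hQ, he⟩⟩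
  have hcard : n.choose q ≤ G.card + ∑ e, (B e).card := by
    have := (Finset.card_le_card hsub).trans (Finset.card_union_le _ _)
    rw [Finset.card_powersetCard, Finset.card_univ, Fintype.card_fin] at this
    exact this.trans (Nat.add_le_add_left Finset.card_biUnion_le _)
  have hcard' : (n.choose q : ℝ) ≤ (G.card : ℝ) + ∑ e, ((B e).card : ℝ) := by exact_mod_cast hcard
  refine hcard'.trans ?_
  refine add_le_add (le_of_eq rfl) ?_
  refine (Finset.sum_le_sum fun e _ => tail hn (y e) (hy e) γ h0 h1).trans ?_
  simp

/-- There is a universal constant `C` such that if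
`q ≥ C·γ⁻²·log((s+1)/δ)` and the full constraint set `C_{r,c,γ}` is nonempty, then for at
least a `(1−δ)` proportion of the `q`-element subsets `Q` of the sites, the sampled
constraint set `C_{(q/n)r, (q/n)c, 2γ}(Q)` is nonempty. -/
theorem sampled_constraints_feasible :
    ∃ C : ℝ, 0 < C ∧
      ∀ (n s q : ℕ) (R L : Fin 4 → Fin 4 → Fin s → Finset (Fin n))
        (r c : Fin 4 → Fin 4 → Fin s → ℝ) (γ δ : ℝ),
        0 < γ → γ < 1 → 0 < δ → δ < 1 → q ≤ n →
        C / γ ^ 2 * Real.log (((s : ℝ) + 1) / δ) ≤ (q : ℝ) →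
        FeasibleOn Finset.univ R L r c γ →
        (1 - δ) * (propCount (fun Q : Finset (Fin n) => Q.card = q) : ℝ) ≤
          (propCount (fun Q : Finset (Fin n) => Q.card = q ∧
            FeasibleOn Q R L (fun i j k => ((q : ℝ) / n) * r i j k)
              (fun i j k => ((q : ℝ) / n) * c i j k) (2 * γ)) : ℝ) := by
  refine ⟨112, by norm_num, ?_⟩
  intro n s q R L r c γ δ h0 h1 hd0 hd1 hqn hq hF
  obtain ⟨ρ, hρ, hR, hL⟩ := hF
  have hρ' : ∀ u, IsDensity (ρ u) := fun u => hρ u (Finset.mem_univ u)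
  have hs1 : (0 : ℝ) < (s : ℝ) + 1 := by positivity
  have hlog : 0 < Real.log (((s : ℝ) + 1) / δ) := by
    apply Real.log_pos
    rw [lt_div_iff₀ hd0]
    have : (0 : ℝ) ≤ s := Nat.cast_nonneg s
    linarith
  have hq0 : (0 : ℝ) < q := lt_of_lt_of_le (by positivity) hq
  have hq0' : 0 < q := by exact_mod_cast hq0
  have hn : 0 < n := lt_of_lt_of_le hq0' hqn
  have hn' : (0 : ℝ) < n := by exact_mod_cast hn
  have htot : propCount (fun Q : Finset (Fin n) => Q.card = q) = n.choose q := by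
    have : @Finset.filter _ (fun Q : Finset (Fin n) => Q.card = q) (Classical.decPred _)
        Finset.univ = (Finset.univ : Finset (Fin n)).powersetCard q := by
      ext Q
      simp [Finset.mem_powersetCard]
    rw [propCount, this, Finset.card_powersetCard, Finset.card_univ, Fintype.card_fin]
  rw [htot]
  let sg : Bool → ℝ := fun b => if b then 1 else -1
  let w : Bool → Fin 4 → Fin 4 → Fin s → Fin n → ℝ := fun b i j k u =>
    if b then (if u ∈ R i j k then mag i (ρ u) else 0)
    else (if u ∈ L i j k then mag j (ρ u) else 0)
  let y : (Fin 4 × Fin 4 × Fin s × Bool × Bool) → Fin n → ℝ := fun e u =>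
    sg e.2.2.2.1 * w e.2.2.2.2 e.1 e.2.1 e.2.2.1 u
  have hw : ∀ b i j k u, |w b i j k u| ≤ 1 := by
    intro b i j k u
    have hi := mag_le i (ρ u) (hρ' u)
    have hj := mag_le j (ρ u) (hρ' u)
    simp only [w]
    split_ifs <;> simp_all
  have hy : ∀ e u, |y e u| ≤ 1 := by
    rintro ⟨i, j, k, b, b'⟩ u
    have := hw b' i j k u
    cases b <;> simpa [y, sg, abs_mul] using this
  have hfin : ∀ (S Q : Finset (Fin n)) (f : Fin n → ℝ) (r₀ : ℝ), Q.card = q →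
      |(∑ u ∈ S, f u) - r₀| ≤ γ * n →
      |(∑ u ∈ S ∩ Q, f u) - (q : ℝ) / n * ∑ u ∈ S, f u| ≤ γ * q →
      |(∑ u ∈ S ∩ Q, f u) - (q : ℝ) / n * r₀| ≤ 2 * γ * Q.card := by
    intro S Q f r₀ hc ha hb
    rw [hc]
    have e : (∑ u ∈ S ∩ Q, f u) - (q : ℝ) / n * r₀ =
        ((∑ u ∈ S ∩ Q, f u) - (q : ℝ) / n * ∑ u ∈ S, f u) +
          (q : ℝ) / n * ((∑ u ∈ S, f u) - r₀) := by ring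
    rw [e]
    refine (abs_add_le _ _).trans ?_
    rw [abs_mul, abs_of_nonneg (by positivity : (0 : ℝ) ≤ (q : ℝ) / n)]
    have h3 := mul_le_mul_of_nonneg_left ha (by positivity : (0 : ℝ) ≤ (q : ℝ) / n)
    have h4 : (q : ℝ) / n * (γ * n) = γ * q := by field_simp
    linarith
  have main := family (q := q) hn y hy γ h0 h1
    (fun Q => FeasibleOn Q R L (fun i j k => ((q : ℝ) / n) * r i j k)
              (fun i j k => ((q : ℝ) / n) * c i j k) (2 * γ)) (by
    intro Q hc hall
    have habs : ∀ b i j k, |∑ u ∈ Q, w b i j k u - (q : ℝ) / n * ∑ u, w b i j k u| ≤ γ * q := by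
      intro b i j k
      have hp := hall (i, j, k, true, b)
      have hm := hall (i, j, k, false, b)
      simp only [y, sg, ← Finset.mul_sum] at hp hm
      simp at hp hm
      rw [abs_le]
      constructor <;> linarith
    refine ⟨ρ, fun u _ => hρ' u, ?_, ?_⟩
    · intro i j k
      refine hfin _ _ _ _ hc (by simpa using hR i j k) ?_
      have := habs true i j k
      simpa [w, Finset.sum_ite_mem, Finset.inter_comm] using this
    · intro i j k
      refine hfin _ _ _ _ hc (by simpa using hL i j k) ?_
      have := habs false i j k
      simpa [w, Finset.sum_ite_mem, Finset.inter_comm] using this)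
  have hexp : Real.exp (-(γ ^ 2 * q / 16)) ≤ (δ / ((s : ℝ) + 1)) ^ 7 := by
    have e1 : (δ / ((s : ℝ) + 1)) ^ 7 = Real.exp (-(7 * Real.log (((s : ℝ) + 1) / δ))) := by
      have : δ / ((s : ℝ) + 1) = Real.exp (-(Real.log (((s : ℝ) + 1) / δ))) := by
        rw [Real.exp_neg, Real.exp_log (by positivity), inv_div]
      rw [this, ← Real.exp_nat_mul]
      congr 1
      push_cast
      ring
    rw [e1, Real.exp_le_exp]
    have := mul_le_mul_of_nonneg_left hq (by positivity : (0 : ℝ) ≤ γ ^ 2)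
    have e2 : γ ^ 2 * (112 / γ ^ 2 * Real.log (((s : ℝ) + 1) / δ)) =
        112 * Real.log (((s : ℝ) + 1) / δ) := by field_simp
    linarith
  have hbound : (Fintype.card (Fin 4 × Fin 4 × Fin s × Bool × Bool) : ℝ) *
      Real.exp (-(γ ^ 2 * q / 16)) ≤ δ := by
    have hcd : (Fintype.card (Fin 4 × Fin 4 × Fin s × Bool × Bool) : ℝ) = 64 * s := by
      simp [Fintype.card_prod]
      ring
    rw [hcd]
    refine (mul_le_mul_of_nonneg_left hexp (by positivity)).trans ?_
    rcases Nat.eq_zero_or_pos s with hs | hs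
    · simp [hs, hd0.le]
    · have hs' : (1 : ℝ) ≤ s := by exact_mod_cast hs
      rw [div_pow, ← mul_div_assoc, div_le_iff₀ (by positivity)]
      have a1 : δ ^ 7 ≤ δ := by
        simpa using pow_le_pow_of_le_one hd0.le hd1.le (by norm_num : 1 ≤ 7)
      have a2 : (64 : ℝ) ≤ ((s : ℝ) + 1) ^ 6 := by
        have : (2 : ℝ) ^ 6 ≤ ((s : ℝ) + 1) ^ 6 := by gcongr; linarith
        norm_num at this ⊢
        exact this
      have a3 : 64 * (s : ℝ) ≤ ((s : ℝ) + 1) ^ 7 := by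
        rw [pow_succ]
        exact mul_le_mul a2 (by linarith) (by positivity) (by positivity)
      calc 64 * (s : ℝ) * δ ^ 7 ≤ ((s : ℝ) + 1) ^ 7 * δ :=
            mul_le_mul a3 a1 (by positivity) (by positivity)
        _ = δ * ((s : ℝ) + 1) ^ 7 := by ring
  have := mul_le_mul_of_nonneg_left hbound (Nat.cast_nonneg (α := ℝ) (n.choose q))
  linarith

end QLH
end
end

section
/- There is a universal constant C with the following property. Fix n qubits, cut data of width s consisting of sets R^{ijk}, L^{ijk} ⊆ {1,…,n} (i,j ∈ {0,1,2,3}, k ∈ {1,…,s}), guesses r = (r^{ijk}), c = (c^{ijk}), tolerance γ ∈ (0,1), δ ∈ (0,1), and an integer q ≤ n with q ≥ C·γ^{−2}·log(1/δ). If the constraint set C_{r,c,γ} is empty, then for at least a (1−δ) proportion of all q-element subsets Q of {1,…,n}, the sampled constraint set C_{(q/n)r, (q/n)c, γ/2}(Q) is empty, where (q/n)r denotes the tuple with entries (q/n)·r^{ijk}. -/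
open scoped BigOperators ComplexOrder

noncomputable section

namespace QLH

theorem sum_erase_eq {n : ℕ} (k : ℕ) (f : Finset (Fin n) → Fin n → ℝ) :
    ∑ P ∈ Finset.powersetCard (k + 1) (Finset.univ : Finset (Fin n)), ∑ u ∈ P, f (P.erase u) u
      = ∑ T ∈ Finset.powersetCard k (Finset.univ : Finset (Fin n)), ∑ u ∈ Tᶜ, f T u := by
  rw [Finset.sum_sigma', Finset.sum_sigma']
  refine Finset.sum_bij' (fun p _ => ⟨p.1.erase p.2, p.2⟩) (fun p _ => ⟨insert p.2 p.1, p.2⟩)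
    ?_ ?_ ?_ ?_ ?_
  · rintro ⟨P, u⟩ h
    simp only [Finset.mem_sigma, Finset.mem_powersetCard] at h ⊢
    simp [Finset.card_erase_of_mem h.2, h.1.2]
  · rintro ⟨P, u⟩ h
    simp only [Finset.mem_sigma, Finset.mem_powersetCard, Finset.mem_compl] at h ⊢
    simp [Finset.card_insert_of_notMem h.2, h.1.2]
  · rintro ⟨P, u⟩ h
    simp only [Finset.mem_sigma] at h
    simp [Finset.insert_erase h.2]
  · rintro ⟨P, u⟩ h
    simp only [Finset.mem_sigma, Finset.mem_compl] at h
    simp [Finset.erase_insert h.2]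
  · rintro ⟨P, u⟩ h
    rfl

/-- Elementary symmetric sums. -/
def esum {n : ℕ} (x : Fin n → ℝ) (k : ℕ) : ℝ :=
  ∑ P ∈ Finset.powersetCard k (Finset.univ : Finset (Fin n)), ∏ u ∈ P, x u

theorem esum_succ {n : ℕ} (x : Fin n → ℝ) (k : ℕ) :
    ((k : ℝ) + 1) * esum x (k + 1) =
      ∑ T ∈ Finset.powersetCard k (Finset.univ : Finset (Fin n)),
        (∏ u ∈ T, x u) * ∑ u ∈ Tᶜ, x u := by
  have h := sum_erase_eq (n := n) k (fun T u => (∏ v ∈ T, x v) * x u)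
  simp only [← Finset.mul_sum] at h
  rw [← h, esum, Finset.mul_sum]
  refine Finset.sum_congr rfl fun P hP => ?_
  rw [Finset.sum_congr rfl (fun u hu => Finset.prod_erase_mul P x hu)]
  simp [(Finset.mem_powersetCard.1 hP).2]

theorem esum_step {n : ℕ} (x : Fin n → ℝ) (hx : ∀ u, 0 ≤ x u) (k : ℕ) (hk : k ≤ n) :
    (n : ℝ) * (((k : ℝ) + 1) * esum x (k + 1)) ≤ ((n : ℝ) - k) * ((∑ u, x u) * esum x k) := by
  rcases k with _ | k
  · rw [esum_succ]
    simp [esum]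
  set A := (((k + 1 : ℕ) : ℝ) + 1) * esum x (k + 1 + 1) with hA
  set B := ∑ P ∈ Finset.powersetCard (k + 1) (Finset.univ : Finset (Fin n)),
        (∏ u ∈ P, x u) * ∑ u ∈ P, x u with hB
  have hAB : A + B = (∑ u, x u) * esum x (k + 1) := by
    rw [hA, hB, esum_succ, ← Finset.sum_add_distrib, esum, Finset.mul_sum]
    refine Finset.sum_congr rfl fun P _ => ?_
    rw [← mul_add, Finset.sum_compl_add_sum, mul_comm]
  have hB2 : B = ∑ T ∈ Finset.powersetCard k (Finset.univ : Finset (Fin n)),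
      (∏ u ∈ T, x u) * ∑ u ∈ Tᶜ, x u ^ 2 := by
    have h := sum_erase_eq (n := n) k (fun T u => (∏ v ∈ T, x v) * x u ^ 2)
    simp only [← Finset.mul_sum] at h
    rw [← h, hB]
    refine Finset.sum_congr rfl fun P hP => ?_
    rw [Finset.mul_sum]
    refine Finset.sum_congr rfl fun u hu => ?_
    rw [← Finset.prod_erase_mul P x hu]
    ring
  have hA2 : ((k : ℝ) + 1) * A = ∑ T ∈ Finset.powersetCard k (Finset.univ : Finset (Fin n)),
      (∏ u ∈ T, x u) * ((∑ u ∈ Tᶜ, x u) ^ 2 - ∑ u ∈ Tᶜ, x u ^ 2) := by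
    have h := sum_erase_eq (n := n) k
      (fun T u => (∏ v ∈ T, x v) * (x u * (∑ v ∈ Tᶜ, x v - x u)))
    have h2 : ∀ T : Finset (Fin n), (∑ u ∈ Tᶜ, x u * (∑ v ∈ Tᶜ, x v - x u)) =
        (∑ u ∈ Tᶜ, x u) ^ 2 - ∑ u ∈ Tᶜ, x u ^ 2 := by
      intro T
      simp only [mul_sub, Finset.sum_sub_distrib, ← Finset.sum_mul, sq]
    simp only [← Finset.mul_sum, h2] at h
    rw [← h, hA, esum_succ, Finset.mul_sum]
    refine Finset.sum_congr rfl fun P hP => ?_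
    have h3 : ∀ u ∈ P, (∏ v ∈ P.erase u, x v) * (x u * (∑ v ∈ (P.erase u)ᶜ, x v - x u)) =
        (∏ v ∈ P, x v) * ∑ v ∈ Pᶜ, x v := by
      intro u hu
      rw [← Finset.prod_erase_mul P x hu, Finset.compl_erase, Finset.sum_insert (by simpa using hu)]
      ring
    rw [Finset.sum_congr rfl h3]
    simp [(Finset.mem_powersetCard.1 hP).2]
  have key : ((k : ℝ) + 1) * A ≤ ((n : ℝ) - ((k : ℝ) + 1)) * B := by
    rw [hA2, hB2, Finset.mul_sum]
    refine Finset.sum_le_sum fun T hT => ?_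
    have hc : ((Tᶜ).card : ℝ) = (n : ℝ) - k := by
      rw [Finset.card_compl, (Finset.mem_powersetCard.1 hT).2, Fintype.card_fin,
        Nat.cast_sub (by omega)]
    have h1 := sq_sum_le_card_mul_sum_sq (s := Tᶜ) (f := x)
    rw [hc] at h1
    have h0 : 0 ≤ ∏ u ∈ T, x u := Finset.prod_nonneg fun u _ => hx u
    nlinarith [mul_le_mul_of_nonneg_left h1 h0]
  rw [← hAB]
  push_cast
  linarith

theorem maclaurin_s17 {n : ℕ} (x : Fin n → ℝ) (hx : ∀ u, 0 ≤ x u) (k : ℕ) (hk : k ≤ n) :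
    (n : ℝ) ^ k * esum x k ≤ (n.choose k : ℝ) * (∑ u, x u) ^ k := by
  induction k with
  | zero => simp [esum]
  | succ k ih =>
    have ih := ih (by omega)
    have hs := esum_step x hx k (by omega)
    have hX : 0 ≤ ∑ u, x u := Finset.sum_nonneg fun u _ => hx u
    have hc : (n.choose (k + 1) : ℝ) * ((k : ℝ) + 1) = (n.choose k : ℝ) * ((n : ℝ) - k) := by
      have := Nat.choose_succ_right_eq n k
      rw [← Nat.cast_sub (by omega)]
      exact_mod_cast this
    have hnk : (0 : ℝ) ≤ (n : ℝ) - k := by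
      rw [sub_nonneg]; exact_mod_cast (by omega : k ≤ n)
    have hk1 : (0 : ℝ) < (k : ℝ) + 1 := by positivity
    refine le_of_mul_le_mul_left ?_ hk1
    calc ((k : ℝ) + 1) * ((n : ℝ) ^ (k + 1) * esum x (k + 1))
        = (n : ℝ) ^ k * ((n : ℝ) * (((k : ℝ) + 1) * esum x (k + 1))) := by ring
      _ ≤ (n : ℝ) ^ k * (((n : ℝ) - k) * ((∑ u, x u) * esum x k)) := by gcongr
      _ = (((n : ℝ) - k) * (∑ u, x u)) * ((n : ℝ) ^ k * esum x k) := by ring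
      _ ≤ (((n : ℝ) - k) * (∑ u, x u)) * ((n.choose k : ℝ) * (∑ u, x u) ^ k) := by gcongr
      _ = ((n.choose k : ℝ) * ((n : ℝ) - k)) * (∑ u, x u) ^ (k + 1) := by ring
      _ = ((k : ℝ) + 1) * ((n.choose (k + 1) : ℝ) * (∑ u, x u) ^ (k + 1)) := by
        rw [← hc]; ring

theorem conc {n q : ℕ} (hn : 0 < n) (hq : q ≤ n) (y : Fin n → ℝ) (hy0 : ∑ u, y u = 0)
    (hy : ∀ u, |y u| ≤ 2) (t : ℝ) (ht : 0 < t) (ht1 : t ≤ 1) (E : Finset (Finset (Fin n)))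
    (hE : ∀ Q ∈ E, Q.card = q ∧ t * q ≤ ∑ u ∈ Q, y u) :
    (E.card : ℝ) ≤ (n.choose q : ℝ) * Real.exp (-(q * t ^ 2 / 16)) := by
  set l := t / 8 with hl
  set x : Fin n → ℝ := fun u => Real.exp (l * y u) with hx
  have hx0 : ∀ u, 0 ≤ x u := fun u => (Real.exp_pos _).le
  have hm := maclaurin_s17 x hx0 q hq
  have hn' : (0 : ℝ) < n := by exact_mod_cast hn
  have hX : ∑ u, x u ≤ n * Real.exp (4 * l ^ 2) := by
    have h1 : ∀ u, x u ≤ 1 + l * y u + 4 * l ^ 2 := by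
      intro u
      have hab := abs_le.1 (hy u)
      have hb : |l * y u| ≤ 1 := by
        rw [abs_mul, abs_of_pos (by positivity : 0 < l)]
        have := hy u
        nlinarith [abs_nonneg (y u)]
      have h2 := (abs_le.1 (Real.abs_exp_sub_one_sub_id_le hb)).2
      have h3 : (y u) ^ 2 ≤ 4 := by nlinarith
      have h4 : (l * y u) ^ 2 ≤ 4 * l ^ 2 := by
        rw [mul_pow]; nlinarith [sq_nonneg l]
      simp only [hx]
      linarith
    calc ∑ u, x u ≤ ∑ u, (1 + l * y u + 4 * l ^ 2) := Finset.sum_le_sum fun u _ => h1 u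
      _ = n * (4 * l ^ 2 + 1) := by
        rw [Finset.sum_add_distrib, Finset.sum_add_distrib, ← Finset.mul_sum, hy0]
        simp
        ring
      _ ≤ n * Real.exp (4 * l ^ 2) := by
        gcongr
        exact Real.add_one_le_exp _
  have hF : esum x q ≤ (n.choose q : ℝ) * Real.exp (4 * l ^ 2) ^ q := by
    have hp : (0 : ℝ) < (n : ℝ) ^ q := by positivity
    refine le_of_mul_le_mul_left ?_ hp
    calc (n : ℝ) ^ q * esum x q ≤ (n.choose q : ℝ) * (∑ u, x u) ^ q := hm
      _ ≤ (n.choose q : ℝ) * (n * Real.exp (4 * l ^ 2)) ^ q := by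
        gcongr
      _ = _ := by rw [mul_pow]; ring
  have hEle : (E.card : ℝ) * Real.exp (l * (t * q)) ≤ esum x q := by
    calc (E.card : ℝ) * Real.exp (l * (t * q)) = ∑ Q ∈ E, Real.exp (l * (t * q)) := by simp
      _ ≤ ∑ Q ∈ E, ∏ u ∈ Q, x u := by
        refine Finset.sum_le_sum fun Q hQ => ?_
        simp only [hx]
        rw [← Real.exp_sum, ← Finset.mul_sum]
        have := (hE Q hQ).2
        gcongr
      _ ≤ esum x q := by
        refine Finset.sum_le_sum_of_subset_of_nonneg ?_ ?_
        · intro Q hQ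
          simp [Finset.mem_powersetCard, (hE Q hQ).1]
        · intro Q _ _
          exact Finset.prod_nonneg fun u _ => hx0 u
  have hpos := Real.exp_pos (l * (t * q))
  refine le_of_mul_le_mul_right ?_ hpos
  refine hEle.trans (hF.trans (le_of_eq ?_))
  rw [mul_assoc, ← Real.exp_add, ← Real.exp_nat_mul]
  congr 2
  rw [hl]; ring

theorem mag_abs_le {ρ : Matrix (Fin 2) (Fin 2) ℂ} (h : IsDensity ρ) (i : Fin 4) :
    |mag i ρ| ≤ 1 := by
  obtain ⟨hp, ht⟩ := h
  have hre := congrArg Complex.re ht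
  have key := fun a b : ℂ => (Complex.le_def.1 (hp.dotProduct_mulVec_nonneg ![a, b])).1
  have k1 := key 1 1
  have k2 := key 1 (-1)
  have k3 := key 1 Complex.I
  have k4 := key 1 (-Complex.I)
  have k5 := key 1 0
  have k6 := key 0 1
  simp [Matrix.trace, Fin.sum_univ_two, Matrix.mulVec, dotProduct] at hre k1 k2 k3 k4 k5 k6
  rw [abs_le]
  fin_cases i <;> simp [mag, pauli, Matrix.trace, Fin.sum_univ_two, Matrix.vecMul, dotProduct] <;>
    constructor <;> linarith

theorem mag_comb (i : Fin 4) (a b : ℝ) (ρ τ : Matrix (Fin 2) (Fin 2) ℂ) :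
    mag i (a • ρ + b • τ) = a * mag i ρ + b * mag i τ := by
  simp [mag, Matrix.mul_add, Matrix.trace_add, Matrix.trace_smul]

theorem density_comb {a b : ℝ} (ha : 0 ≤ a) (hb : 0 ≤ b) (hab : a + b = 1)
    {ρ τ : Matrix (Fin 2) (Fin 2) ℂ} (hρ : IsDensity ρ) (hτ : IsDensity τ) :
    IsDensity (a • ρ + b • τ) := by
  refine ⟨(hρ.1.smul ha).add (hτ.1.smul hb), ?_⟩
  rw [Matrix.trace_add, Matrix.trace_smul, Matrix.trace_smul, hρ.2, hτ.2, ← add_smul, hab, one_smul]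

theorem exists_density : ∃ ρ : Matrix (Fin 2) (Fin 2) ℂ, IsDensity ρ := by
  refine ⟨(1 / 2 : ℝ) • 1, Matrix.PosSemidef.one.smul (by norm_num), ?_⟩
  simp [Matrix.trace_smul]

/-- Linear programming duality for the infeasible system. -/
theorem dual_certificate {n : ℕ} (hn : 0 < n) {ι : Type} [Fintype ι] [DecidableEq ι]
    (S : ι → Finset (Fin n)) (p : ι → Fin 4) (g : ι → ℝ) (γ : ℝ) (hγ : 0 < γ)
    (hinf : ¬ ∃ ρ : Fin n → Matrix (Fin 2) (Fin 2) ℂ, (∀ u, IsDensity (ρ u)) ∧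
      ∀ c, |(∑ u ∈ S c, mag (p c) (ρ u)) - g c| ≤ γ * n) :
    ∃ w : ι → ℝ, 0 < ∑ c, |w c| ∧
      ∀ ρ : Fin n → Matrix (Fin 2) (Fin 2) ℂ, (∀ u, IsDensity (ρ u)) →
        γ * n * ∑ c, |w c| ≤ ∑ c, w c * ((∑ u ∈ S c, mag (p c) (ρ u)) - g c) := by
  have hn' : (0 : ℝ) < n := by exact_mod_cast hn
  have hgn : 0 < γ * n := by positivity
  set K : Set (ι → ℝ) := {z | ∃ ρ : Fin n → Matrix (Fin 2) (Fin 2) ℂ, (∀ u, IsDensity (ρ u)) ∧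
      ∀ c, z c = (∑ u ∈ S c, mag (p c) (ρ u)) - g c} with hK
  have hKc : Convex ℝ K := by
    rintro z ⟨ρ, hρ, hz⟩ z' ⟨τ, hτ, hz'⟩ a b ha hb hab
    refine ⟨fun u => a • ρ u + b • τ u, fun u => density_comb ha hb hab (hρ u) (hτ u), ?_⟩
    intro c
    simp only [mag_comb, Finset.sum_add_distrib, ← Finset.mul_sum, Pi.add_apply, Pi.smul_apply,
      smul_eq_mul, hz, hz']
    linear_combination (-(g c)) * hab
  have hdisj : Disjoint (Metric.ball (0 : ι → ℝ) (γ * n)) K := by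
    rw [Set.disjoint_left]
    rintro z hz ⟨ρ, hρ, hzρ⟩
    refine hinf ⟨ρ, hρ, fun c => ?_⟩
    rw [← hzρ c, ← Real.norm_eq_abs]
    rw [mem_ball_zero_iff] at hz
    exact (norm_le_pi_norm z c).trans hz.le
  obtain ⟨f, v, hf1, hf2⟩ := geometric_hahn_banach_open (convex_ball (0 : ι → ℝ) (γ * n))
    Metric.isOpen_ball hKc hdisj
  set w : ι → ℝ := fun c => f (Pi.single c 1) with hw
  have hfw : ∀ z : ι → ℝ, f z = ∑ c, w c * z c := by
    intro z
    have := LinearMap.pi_apply_eq_sum_univ (f : (ι → ℝ) →ₗ[ℝ] ℝ) z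
    simp only [ContinuousLinearMap.coe_coe, smul_eq_mul] at this
    rw [this]
    refine Finset.sum_congr rfl fun c _ => ?_
    rw [mul_comm, hw]
    congr 2
    ext d
    simp [Pi.single_apply, eq_comm]
  have hv : 0 < v := by
    have := hf1 0 (by simpa using hgn)
    simpa using this
  have hW0 : 0 ≤ ∑ c, |w c| := Finset.sum_nonneg fun c _ => abs_nonneg _
  have hWv : γ * n * ∑ c, |w c| ≤ v := by
    by_contra! hlt
    have hWp : 0 < γ * n * ∑ c, |w c| := hv.trans hlt
    set e := v / (γ * n * ∑ c, |w c|) with he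
    have he0 : 0 < e := by positivity
    have he1 : e < 1 := by rw [he, div_lt_one hWp]; exact hlt
    have hb : (fun c => e * (γ * n) * (SignType.sign (w c) : ℝ)) ∈
        Metric.ball (0 : ι → ℝ) (γ * n) := by
      rw [mem_ball_zero_iff, pi_norm_lt_iff hgn]
      intro c
      rw [Real.norm_eq_abs, abs_mul, abs_of_pos (by positivity : 0 < e * (γ * n))]
      have : |(SignType.sign (w c) : ℝ)| ≤ 1 := by
        rcases lt_trichotomy (w c) 0 with h | h | h <;> simp [h]
      calc e * (γ * n) * |(SignType.sign (w c) : ℝ)| ≤ e * (γ * n) * 1 := by gcongr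
        _ < γ * n := by nlinarith
    have h := hf1 _ hb
    rw [hfw] at h
    have h2 : ∑ c, w c * (e * (γ * n) * (SignType.sign (w c) : ℝ)) = v := by
      have : ∀ c, w c * (e * (γ * n) * (SignType.sign (w c) : ℝ)) = e * (γ * n) * |w c| := by
        intro c
        rw [← self_mul_sign (w c)]; ring
      rw [Finset.sum_congr rfl fun c _ => this c, ← Finset.mul_sum, mul_assoc, he]
      exact div_mul_cancel₀ _ hWp.ne'
    linarith
  refine ⟨w, ?_, ?_⟩
  · rcases hW0.lt_or_eq with h | h
    · exact h
    exfalso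
    obtain ⟨ρ, hρ⟩ := exists_density
    have h1 := hf2 (fun c => (∑ u ∈ S c, mag (p c) ρ) - g c) ⟨fun _ => ρ, fun _ => hρ, fun _ => rfl⟩
    have hz := (Finset.sum_eq_zero_iff_of_nonneg fun c _ => abs_nonneg (w c)).1 h.symm
    rw [hfw, Finset.sum_eq_zero] at h1
    · linarith
    · intro c hc
      rw [abs_eq_zero.1 (hz c hc), zero_mul]
  · intro ρ hρ
    have h1 := hf2 (fun c => (∑ u ∈ S c, mag (p c) (ρ u)) - g c) ⟨ρ, hρ, fun _ => rfl⟩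
    rw [hfw] at h1
    exact hWv.trans h1

/-- Abstract form of the theorem: bound on the bad sets. -/
theorem bad_card {n q : ℕ} (hn : 0 < n) (hq : q ≤ n) {ι : Type} [Fintype ι] [DecidableEq ι]
    (S : ι → Finset (Fin n)) (p : ι → Fin 4) (g : ι → ℝ) (γ : ℝ) (hγ : 0 < γ) (hγ1 : γ < 1)
    (hinf : ¬ ∃ ρ : Fin n → Matrix (Fin 2) (Fin 2) ℂ, (∀ u, IsDensity (ρ u)) ∧
      ∀ c, |(∑ u ∈ S c, mag (p c) (ρ u)) - g c| ≤ γ * n)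
    (E : Finset (Finset (Fin n)))
    (hE : ∀ Q ∈ E, Q.card = q ∧ ∃ ρ : Fin n → Matrix (Fin 2) (Fin 2) ℂ,
      (∀ u ∈ Q, IsDensity (ρ u)) ∧
      ∀ c, |(∑ u ∈ S c ∩ Q, mag (p c) (ρ u)) - (q : ℝ) / n * g c| ≤ γ / 2 * q) :
    (E.card : ℝ) ≤ (n.choose q : ℝ) * Real.exp (-(q * (γ / 4) ^ 2 / 16)) := by
  have hn' : (0 : ℝ) < n := by exact_mod_cast hn
  obtain ⟨w, hW, hcert⟩ := dual_certificate hn S p g γ hγ hinf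
  set W := ∑ c, |w c| with hWdef
  set h : Fin n → Matrix (Fin 2) (Fin 2) ℂ → ℝ :=
    fun u ρ => ∑ c, if u ∈ S c then w c * mag (p c) ρ else 0 with hh
  have hsum : ∀ (Q : Finset (Fin n)) (ρ : Fin n → Matrix (Fin 2) (Fin 2) ℂ),
      ∑ u ∈ Q, h u (ρ u) = ∑ c, w c * ∑ u ∈ S c ∩ Q, mag (p c) (ρ u) := by
    intro Q ρ
    simp only [hh]
    rw [Finset.sum_comm]
    refine Finset.sum_congr rfl fun c _ => ?_
    rw [Finset.inter_comm, ← Finset.filter_mem_eq_inter, Finset.mul_sum, Finset.sum_filter]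
  have habs : ∀ u ρ, IsDensity ρ → |h u ρ| ≤ W := by
    intro u ρ hρ
    refine (Finset.abs_sum_le_sum_abs _ _).trans (Finset.sum_le_sum fun c _ => ?_)
    split_ifs
    · rw [abs_mul]
      exact mul_le_of_le_one_right (abs_nonneg _) (mag_abs_le hρ _)
    · simp
  have hmin : ∀ u, ∃ ρ, IsDensity ρ ∧ ∀ τ, IsDensity τ → h u ρ ≤ h u τ + W * γ / 4 := by
    intro u
    set T : Set ℝ := {z | ∃ ρ, IsDensity ρ ∧ h u ρ = z} with hT
    obtain ⟨ρ0, hρ0⟩ := exists_density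
    have hne : T.Nonempty := ⟨_, ρ0, hρ0, rfl⟩
    have hbdd : BddBelow T := ⟨-W, by
      rintro z ⟨ρ, hρ, rfl⟩
      exact (abs_le.1 (habs u ρ hρ)).1⟩
    obtain ⟨z, ⟨ρ, hρ, rfl⟩, hz⟩ := exists_lt_of_csInf_lt hne
      (show sInf T < sInf T + W * γ / 4 by linarith [show 0 < W * γ / 4 by positivity])
    refine ⟨ρ, hρ, fun τ hτ => ?_⟩
    have := csInf_le hbdd (⟨τ, hτ, rfl⟩ : h u τ ∈ T)
    linarith
  choose ρs hρs hρmin using hmin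
  set a : Fin n → ℝ := fun u => h u (ρs u) with ha
  have hac := hcert ρs hρs
  have hasum := hsum Finset.univ ρs
  simp only [Finset.inter_univ] at hasum
  simp only [mul_sub, Finset.sum_sub_distrib] at hac
  rw [← hasum] at hac
  set G := ∑ c, w c * g c with hG
  set M := ∑ u, a u with hM
  have haW : ∀ u, |a u| ≤ W := fun u => habs u _ (hρs u)
  have hMW : |M| ≤ n * W := by
    refine (Finset.abs_sum_le_sum_abs _ _).trans ?_
    refine (Finset.sum_le_sum fun u _ => haW u).trans ?_
    simp
  refine conc hn hq (fun u => (M / n - a u) / W) ?_ ?_ (γ / 4) (by positivity) (by linarith) E ?_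
  · rw [← Finset.sum_div, Finset.sum_sub_distrib]
    simp only [Finset.sum_const, Finset.card_univ, Fintype.card_fin, nsmul_eq_mul]
    rw [mul_div_cancel₀ _ hn'.ne', ← hM, sub_self, zero_div]
  · intro u
    rw [abs_div, abs_of_pos hW, div_le_iff₀ hW]
    have h1 : |M / n| ≤ W := by
      rw [abs_div, abs_of_pos hn', div_le_iff₀ hn']; linarith
    have h2 := abs_sub (M / n) (a u)
    linarith [haW u]
  · intro Q hQ
    obtain ⟨hc, ρ, hρ, hfe⟩ := hE Q hQ
    refine ⟨hc, ?_⟩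
    rw [← Finset.sum_div, le_div_iff₀ hW, Finset.sum_sub_distrib]
    simp only [Finset.sum_const, nsmul_eq_mul, hc]
    have h1 : ∑ u ∈ Q, a u ≤ ∑ u ∈ Q, h u (ρ u) + q * (W * γ / 4) := by
      have := Finset.sum_le_sum fun u hu => hρmin u (ρ u) (hρ u hu)
      rw [Finset.sum_add_distrib] at this
      simpa [hc] using this
    have h2 : ∑ u ∈ Q, h u (ρ u) ≤ (q : ℝ) / n * G + W * (γ / 2 * q) := by
      rw [hsum, hG, Finset.mul_sum, hWdef, Finset.sum_mul, ← Finset.sum_add_distrib]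
      refine Finset.sum_le_sum fun c _ => ?_
      have h3 := le_abs_self (w c * ((∑ u ∈ S c ∩ Q, mag (p c) (ρ u)) - (q : ℝ) / n * g c))
      rw [abs_mul] at h3
      have h4 := mul_le_mul_of_nonneg_left (hfe c) (abs_nonneg (w c))
      linarith
    have h5 : (q : ℝ) / n * G ≤ q * (M / n) - γ * q * W := by
      have : (q : ℝ) / n * (γ * n * W) ≤ (q : ℝ) / n * (M - G) := by gcongr
      have e1 : (q : ℝ) / n * (γ * n * W) = γ * q * W := by field_simp
      have e2 : (q : ℝ) / n * (M - G) = q * (M / n) - (q : ℝ) / n * G := by ring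
      linarith
    linarith

theorem feasible_abs {n s : ℕ} (Q : Finset (Fin n))
    (R L : Fin 4 → Fin 4 → Fin s → Finset (Fin n))
    (r c : Fin 4 → Fin 4 → Fin s → ℝ) (γ a : ℝ) :
    FeasibleOn Q R L (fun i j k => a * r i j k) (fun i j k => a * c i j k) γ ↔
      ∃ ρ : Fin n → Matrix (Fin 2) (Fin 2) ℂ, (∀ u ∈ Q, IsDensity (ρ u)) ∧
      ∀ d : (Fin 4 × Fin 4 × Fin s) ⊕ (Fin 4 × Fin 4 × Fin s),
        |(∑ u ∈ (Sum.elim (fun x => R x.1 x.2.1 x.2.2) (fun x => L x.1 x.2.1 x.2.2) d) ∩ Q,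
          mag (Sum.elim (fun x => x.1) (fun x => x.2.1) d) (ρ u)) -
          a * (Sum.elim (fun x => r x.1 x.2.1 x.2.2) (fun x => c x.1 x.2.1 x.2.2) d)|
        ≤ γ * Q.card := by
  simp [FeasibleOn]

/-- There is a universal constant `C` such that if
`q ≥ C·γ⁻²·log(1/δ)` and the full constraint set `C_{r,c,γ}` is empty, then for at least a
`(1−δ)` proportion of the `q`-element subsets `Q` of the sites, the sampled constraint set
`C_{(q/n)r, (q/n)c, γ/2}(Q)` is empty. -/
theorem sampled_constraints_infeasible :
    ∃ C : ℝ, 0 < C ∧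
      ∀ (n s q : ℕ) (R L : Fin 4 → Fin 4 → Fin s → Finset (Fin n))
        (r c : Fin 4 → Fin 4 → Fin s → ℝ) (γ δ : ℝ),
        0 < γ → γ < 1 → 0 < δ → δ < 1 → q ≤ n →
        C / γ ^ 2 * Real.log (1 / δ) ≤ (q : ℝ) →
        ¬ FeasibleOn Finset.univ R L r c γ →
        (1 - δ) * (propCount (fun Q : Finset (Fin n) => Q.card = q) : ℝ) ≤
          (propCount (fun Q : Finset (Fin n) => Q.card = q ∧
            ¬ FeasibleOn Q R L (fun i j k => ((q : ℝ) / n) * r i j k)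
              (fun i j k => ((q : ℝ) / n) * c i j k) (γ / 2)) : ℝ) := by
  refine ⟨256, by norm_num, ?_⟩
  intro n s q R L r c γ δ hγ hγ1 hδ hδ1 hq hlog hinf
  have hlogpos : 0 < Real.log (1 / δ) := Real.log_pos (by rw [lt_div_iff₀ hδ]; linarith)
  have hq0 : (0 : ℝ) < q := lt_of_lt_of_le (by positivity) hlog
  have hn : 0 < n := lt_of_lt_of_le (by exact_mod_cast hq0) hq
  have hinf' := (feasible_abs Finset.univ R L r c γ 1).not.1 (by simpa using hinf)
  simp only [Finset.inter_univ, one_mul, Finset.card_univ, Fintype.card_fin, Finset.mem_univ,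
    true_imp_iff] at hinf'
  set F : Finset (Fin n) → Prop := fun Q => FeasibleOn Q R L (fun i j k => ((q : ℝ) / n) * r i j k)
              (fun i j k => ((q : ℝ) / n) * c i j k) (γ / 2) with hF
  classical
  have hb := bad_card hn hq _ _ _ γ hγ hγ1 hinf'
    (Finset.univ.filter fun Q : Finset (Fin n) => Q.card = q ∧ F Q) (by
      intro Q hQ
      obtain ⟨hc, hf⟩ := (Finset.mem_filter.1 hQ).2
      refine ⟨hc, ?_⟩
      have := (feasible_abs Q R L r c (γ / 2) ((q : ℝ) / n)).1 hf
      rwa [hc] at this)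
  have hexp : Real.exp (-(q * (γ / 4) ^ 2 / 16)) ≤ δ := by
    rw [← Real.le_log_iff_exp_le hδ]
    rw [one_div, Real.log_inv, div_mul_eq_mul_div, div_le_iff₀ (by positivity)] at hlog
    nlinarith
  have htot : propCount (fun Q : Finset (Fin n) => Q.card = q) = n.choose q := by
    unfold propCount
    have := Finset.card_powersetCard q (Finset.univ : Finset (Fin n))
    rw [Finset.card_univ, Fintype.card_fin] at this
    rw [← this]
    congr 1
    ext Q
    simp [Finset.mem_powersetCard]
  have hsplit : propCount (fun Q : Finset (Fin n) => Q.card = q) =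
      (Finset.univ.filter fun Q : Finset (Fin n) => Q.card = q ∧ F Q).card +
      propCount (fun Q : Finset (Fin n) => Q.card = q ∧ ¬ F Q) := by
    unfold propCount
    rw [← Finset.card_filter_add_card_filter_not (p := F), Finset.filter_filter,
      Finset.filter_filter]
    congr!
  have hs' : (propCount (fun Q : Finset (Fin n) => Q.card = q) : ℝ) =
      ((Finset.univ.filter fun Q : Finset (Fin n) => Q.card = q ∧ F Q).card : ℝ) +
      (propCount (fun Q : Finset (Fin n) => Q.card = q ∧ ¬ F Q) : ℝ) := by
    exact_mod_cast hsplit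
  have hle := mul_le_mul_of_nonneg_left hexp (Nat.cast_nonneg (α := ℝ) (n.choose q))
  rw [← htot] at hle hb
  linarith

end QLH
end
end
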